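/- arXiv:1205.4995 — 5 statements merged into one kernel-verified Lean document; each statement's English description precedes it below -/
import Mathlib

section
/- Let (τ, u, S) be a C² solution of the one-dimensional Lagrangian compressible Euler equations for a polytropic ideal gas with τ > 0. Then the gradient variables y and q satisfy the Riccati equations ∂₊y = a₀ + a₂ y² and ∂₋q = a₀ + a₂ q², where a₀ = (K_c/γ)[((γ−1)/(3γ−1)) m m_{xx} − ((3γ+1)(γ−1)/(3γ−1)²) m_x²] m^{−3(3−γ)/(2(3γ−1))} η^{3(γ+1)/(2(γ−1)) + 1} and a₂ = −K_c ((γ+1)/(2(γ−1))) m^{3(3−γ)/(2(3γ−1))} η^{(γ+1)/(2(γ−1)) − 1} < 0. -/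
open Real

/-- partial derivative in the first (space) variable -/
noncomputable def pdx (f : ℝ → ℝ → ℝ) (x t : ℝ) : ℝ := deriv (fun x' => f x' t) x
/-- partial derivative in the second (time) variable -/
noncomputable def pdt (f : ℝ → ℝ → ℝ) (x t : ℝ) : ℝ := deriv (fun t' => f x t') t

lemma hasDerivAt_pdx {f : ℝ → ℝ → ℝ} (hf : Differentiable ℝ (fun z : ℝ × ℝ => f z.1 z.2))
    (x t : ℝ) : HasDerivAt (fun x' => f x' t) (pdx f x t) x := by
  have h : DifferentiableAt ℝ (fun x' => f x' t) x :=
    (hf (x, t)).comp (f := fun x' : ℝ => (x', t)) x (by fun_prop)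
  exact h.hasDerivAt

lemma hasDerivAt_pdt {f : ℝ → ℝ → ℝ} (hf : Differentiable ℝ (fun z : ℝ × ℝ => f z.1 z.2))
    (x t : ℝ) : HasDerivAt (fun t' => f x t') (pdt f x t) t := by
  have h : DifferentiableAt ℝ (fun t' => f x t') t :=
    (hf (x, t)).comp (f := fun t' : ℝ => (x, t')) t (by fun_prop)
  exact h.hasDerivAt

lemma pdx_eq_of_hasDerivAt {f : ℝ → ℝ → ℝ} {g : ℝ → ℝ} {g' x t : ℝ}
    (h : HasDerivAt g g' x) (hfg : ∀ x', f x' t = g x') : pdx f x t = g' := by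
  simpa only [pdx, hfg] using h.deriv

lemma pdt_eq_of_hasDerivAt {f : ℝ → ℝ → ℝ} {g : ℝ → ℝ} {g' x t : ℝ}
    (h : HasDerivAt g g' t) (hfg : ∀ t', f x t' = g t') : pdt f x t = g' := by
  simpa only [pdt, hfg] using h.deriv

lemma pdx_eq_fderiv {f : ℝ → ℝ → ℝ} (hf : Differentiable ℝ (fun z : ℝ × ℝ => f z.1 z.2))
    (x t : ℝ) : pdx f x t = fderiv ℝ (fun z : ℝ × ℝ => f z.1 z.2) (x, t) (1, 0) :=
  ((hf (x, t)).hasFDerivAt.comp_hasDerivAt (f := fun x' => (x', t)) x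
    ((hasDerivAt_id' x).prodMk (hasDerivAt_const x t))).deriv

lemma pdt_eq_fderiv {f : ℝ → ℝ → ℝ} (hf : Differentiable ℝ (fun z : ℝ × ℝ => f z.1 z.2))
    (x t : ℝ) : pdt f x t = fderiv ℝ (fun z : ℝ × ℝ => f z.1 z.2) (x, t) (0, 1) :=
  ((hf (x, t)).hasFDerivAt.comp_hasDerivAt (f := fun t' => (x, t')) t
    ((hasDerivAt_const t x).prodMk (hasDerivAt_id' t))).deriv

lemma contDiff_pdx {f : ℝ → ℝ → ℝ} (hf : ContDiff ℝ 2 (fun z : ℝ × ℝ => f z.1 z.2)) :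
    ContDiff ℝ 1 (fun z : ℝ × ℝ => pdx f z.1 z.2) := by
  simp only [pdx_eq_fderiv (hf.differentiable two_ne_zero)]
  exact (hf.fderiv_right (m := 1) (by norm_num)).clm_apply contDiff_const

lemma contDiff_pdt {f : ℝ → ℝ → ℝ} (hf : ContDiff ℝ 2 (fun z : ℝ × ℝ => f z.1 z.2)) :
    ContDiff ℝ 1 (fun z : ℝ × ℝ => pdt f z.1 z.2) := by
  simp only [pdt_eq_fderiv (hf.differentiable two_ne_zero)]
  exact (hf.fderiv_right (m := 1) (by norm_num)).clm_apply contDiff_const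

lemma pdt_pdx_comm {f : ℝ → ℝ → ℝ} (hf : ContDiff ℝ 2 (fun z : ℝ × ℝ => f z.1 z.2))
    (x t : ℝ) : pdt (pdx f) x t = pdx (pdt f) x t := by
  have hd := hf.differentiable two_ne_zero
  have h2 : Differentiable ℝ (fderiv ℝ (fun z : ℝ × ℝ => f z.1 z.2)) :=
    (hf.fderiv_right (m := 1) (by norm_num)).differentiable one_ne_zero
  rw [pdt_eq_fderiv ((contDiff_pdx hf).differentiable one_ne_zero),
    pdx_eq_fderiv ((contDiff_pdt hf).differentiable one_ne_zero)]
  simp only [pdx_eq_fderiv hd, pdt_eq_fderiv hd]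
  rw [fderiv_clm_apply (h2 _) (differentiableAt_const _),
    fderiv_clm_apply (h2 _) (differentiableAt_const _)]
  simpa using (hf.contDiffAt.isSymmSndFDerivAt (x := (x, t)) (by simp)) (0, 1) (1, 0)

/-- Riccati equation along the characteristics of speed `ε m k(η)`, `k(η) = Kc η ^ δ`, for a
solution of the Euler equations written in the variables `m`, `η`, `u`. -/
lemma riccati_of_characteristic_form {γ Kc ε : ℝ} (hγ : 1 < γ) (hε : ε ^ 2 = 1)
    {m η u y : ℝ → ℝ → ℝ}
    (hm : ContDiff ℝ 2 (fun z : ℝ × ℝ => m z.1 z.2))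
    (hη : ContDiff ℝ 2 (fun z : ℝ × ℝ => η z.1 z.2))
    (hu : ContDiff ℝ 2 (fun z : ℝ × ℝ => u z.1 z.2))
    (hmpos : ∀ x t, 0 < m x t) (hηpos : ∀ x t, 0 < η x t)
    (hmt : ∀ x t, pdt m x t = 0)
    (hηt : ∀ x t, pdt η x t = -(Kc * η x t ^ ((γ + 1) / (γ - 1)) * pdx u x t))
    (hut : ∀ x t, pdt u x t = -(m x t * (Kc * η x t ^ ((γ + 1) / (γ - 1)))
      * ((γ - 1) / γ * (pdx m x t * η x t) + m x t * pdx η x t)))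
    (hy : ∀ x t, y x t =
      m x t ^ (-(3 * (3 - γ) / (2 * (3 * γ - 1)))) * η x t ^ ((γ + 1) / (2 * (γ - 1)))
        * (pdx u x t + ε * (m x t * pdx η x t
          + 3 * (γ - 1) / (3 * γ - 1) * (pdx m x t * η x t)))) (x t : ℝ) :
    pdt y x t + ε * (Kc * m x t * η x t ^ ((γ + 1) / (γ - 1))) * pdx y x t =
      Kc / γ * ((γ - 1) / (3 * γ - 1) * (m x t * pdx (pdx m) x t)
          - (3 * γ + 1) * (γ - 1) / (3 * γ - 1) ^ 2 * (pdx m x t) ^ 2)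
        * m x t ^ (-(3 * (3 - γ) / (2 * (3 * γ - 1))))
        * η x t ^ (3 * (γ + 1) / (2 * (γ - 1)) + 1)
      + -(Kc * ((γ + 1) / (2 * (γ - 1))) * m x t ^ (3 * (3 - γ) / (2 * (3 * γ - 1)))
        * η x t ^ ((γ + 1) / (2 * (γ - 1)) - 1)) * y x t ^ 2 := by
  have hγ0 : γ ≠ 0 := by linarith
  have hγ1 : γ - 1 ≠ 0 := by linarith
  have hγ3 : 3 * γ - 1 ≠ 0 := by linarith
  have hM := hmpos x t
  have hN := hηpos x t
  have dm := hm.differentiable two_ne_zero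
  have dη := hη.differentiable two_ne_zero
  have dmx := (contDiff_pdx hm).differentiable one_ne_zero
  have dηx := (contDiff_pdx hη).differentiable one_ne_zero
  have dux := (contDiff_pdx hu).differentiable one_ne_zero
  have hmxt : pdt (pdx m) x t = 0 := by
    rw [pdt_pdx_comm hm]
    simp [pdx, hmt]
  have hηxt : pdt (pdx η) x t =
      -(Kc * (pdx η x t * ((γ + 1) / (γ - 1)) * η x t ^ ((γ + 1) / (γ - 1) - 1)) * pdx u x t
        + Kc * η x t ^ ((γ + 1) / (γ - 1)) * pdx (pdx u) x t) := by
    rw [pdt_pdx_comm hη]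
    exact pdx_eq_of_hasDerivAt ((((hasDerivAt_pdx dη x t).rpow_const (p := (γ + 1) / (γ - 1))
      (Or.inl hN.ne')).const_mul Kc).fun_mul (hasDerivAt_pdx dux x t)).fun_neg (fun x' => hηt x' t)
  have huxt := pdx_eq_of_hasDerivAt (((hasDerivAt_pdx dm x t).fun_mul
      (((hasDerivAt_pdx dη x t).rpow_const (p := (γ + 1) / (γ - 1))
      (Or.inl hN.ne')).const_mul Kc)).fun_mul
      ((((hasDerivAt_pdx dmx x t).fun_mul (hasDerivAt_pdx dη x t)).const_mul ((γ - 1) / γ)).fun_add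
        ((hasDerivAt_pdx dm x t).fun_mul (hasDerivAt_pdx dηx x t)))).fun_neg (fun x' => hut x' t)
  rw [← pdt_pdx_comm hu] at huxt
  have hyt := pdt_eq_of_hasDerivAt
    ((((hasDerivAt_pdt dm x t).rpow_const (p := -(3 * (3 - γ) / (2 * (3 * γ - 1))))
      (Or.inl hM.ne')).fun_mul ((hasDerivAt_pdt dη x t).rpow_const
        (p := (γ + 1) / (2 * (γ - 1))) (Or.inl hN.ne'))).fun_mul
      ((hasDerivAt_pdt dux x t).fun_add
      ((((hasDerivAt_pdt dm x t).fun_mul (hasDerivAt_pdt dηx x t)).fun_add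
        (((hasDerivAt_pdt dmx x t).fun_mul (hasDerivAt_pdt dη x t)).const_mul
          (3 * (γ - 1) / (3 * γ - 1)))).const_mul ε))) (fun t' => hy x t')
  have hyx := pdx_eq_of_hasDerivAt
    ((((hasDerivAt_pdx dm x t).rpow_const (p := -(3 * (3 - γ) / (2 * (3 * γ - 1))))
      (Or.inl hM.ne')).fun_mul ((hasDerivAt_pdx dη x t).rpow_const
        (p := (γ + 1) / (2 * (γ - 1))) (Or.inl hN.ne'))).fun_mul
      ((hasDerivAt_pdx dux x t).fun_add
      ((((hasDerivAt_pdx dm x t).fun_mul (hasDerivAt_pdx dηx x t)).fun_add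
        (((hasDerivAt_pdx dmx x t).fun_mul (hasDerivAt_pdx dη x t)).const_mul
          (3 * (γ - 1) / (3 * γ - 1)))).const_mul ε))) (fun x' => hy x' t)
  simp only [hmxt, hηxt, huxt, hmt, hηt] at hyt
  rw [hyt, hyx, hy]
  have e1 : (γ + 1) / (γ - 1) = (γ + 1) / (2 * (γ - 1)) + (γ + 1) / (2 * (γ - 1)) := by
    field_simp; ring
  have e2 : 3 * (γ + 1) / (2 * (γ - 1)) + 1 =
      (γ + 1) / (2 * (γ - 1)) + (γ + 1) / (2 * (γ - 1)) + (γ + 1) / (2 * (γ - 1)) + 1 := by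
    field_simp; ring
  have r1 : η x t ^ ((γ + 1) / (γ - 1)) = (η x t ^ ((γ + 1) / (2 * (γ - 1)))) ^ 2 := by
    rw [e1, rpow_add hN, sq]
  have r2 : η x t ^ (3 * (γ + 1) / (2 * (γ - 1)) + 1) =
      (η x t ^ ((γ + 1) / (2 * (γ - 1)))) ^ 3 * η x t := by
    rw [e2, rpow_add_one hN.ne', rpow_add hN, rpow_add hN]; ring
  have r3 : m x t ^ (-(3 * (3 - γ) / (2 * (3 * γ - 1)))) =
      (m x t ^ (3 * (3 - γ) / (2 * (3 * γ - 1))))⁻¹ := rpow_neg hM.le _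
  rw [rpow_sub_one hN.ne', rpow_sub_one hN.ne', rpow_sub_one hM.ne', r1, r2, r3]
  have hF : m x t ^ (3 * (3 - γ) / (2 * (3 * γ - 1))) ≠ 0 := (rpow_pos_of_pos hM _).ne'
  generalize m x t ^ (3 * (3 - γ) / (2 * (3 * γ - 1))) = F at *
  generalize η x t ^ ((γ + 1) / (2 * (γ - 1))) = G at *
  clear hyt hyx huxt hηxt hmxt r1 r2 r3 e1 e2
  generalize pdx (pdx u) x t = uxx
  generalize pdx (pdx η) x t = ηxx
  generalize pdx (pdx m) x t = mxx
  generalize pdx u x t = ux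
  generalize pdx η x t = ηx
  generalize pdx m x t = mx
  generalize m x t = M at *
  generalize η x t = N at *
  have hM0 := hM.ne'
  have hN0 := hN.ne'
  clear hM hN
  rcases sq_eq_sq_iff_eq_or_eq_neg.mp (hε.trans (one_pow 2).symm) with rfl | rfl <;> field_simp <;> ring

/-- the gradient variables `y` and `q` of a C² solution of the
one-dimensional Lagrangian compressible Euler equations satisfy the decoupled
Riccati equations `∂₊y = a₀ + a₂ y²`, `∂₋q = a₀ + a₂ q²`. -/
theorem stmt7
    (K ctau γ : ℝ) (hK : 0 < K) (hctau : 0 < ctau) (hγ : 1 < γ)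
    (Ktau Kc : ℝ)
    (hKtau : Ktau = (2 * Real.sqrt (K * γ) / (γ - 1)) ^ ((2:ℝ) / (γ - 1)))
    (hKc : Kc = Real.sqrt (K * γ) * Ktau ^ (-((γ + 1) / 2)))
    (τ u S : ℝ → ℝ → ℝ)
    (hτreg : ContDiff ℝ 2 (fun q : ℝ × ℝ => τ q.1 q.2))
    (hureg : ContDiff ℝ 2 (fun q : ℝ × ℝ => u q.1 q.2))
    (hSreg : ContDiff ℝ 2 (fun q : ℝ × ℝ => S q.1 q.2))
    (hτpos : ∀ x t, 0 < τ x t)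
    (p e : ℝ → ℝ → ℝ)
    (hp : ∀ x t, p x t = K * Real.exp (S x t / ctau) * τ x t ^ (-γ))
    (he : ∀ x t, e x t = p x t * τ x t / (γ - 1))
    (hmass : ∀ x t, pdt τ x t - pdx u x t = 0)
    (hmom : ∀ x t, pdt u x t + pdx p x t = 0)
    (hen : ∀ x t,
      pdt (fun x' t' => u x' t' ^ 2 / 2 + e x' t') x t
        + pdx (fun x' t' => u x' t' * p x' t') x t = 0)
    (m η c : ℝ → ℝ → ℝ)
    (hm : ∀ x t, m x t = Real.exp (S x t / (2 * ctau)))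
    (hη : ∀ x t, η x t = 2 * Real.sqrt (K * γ) / (γ - 1) * τ x t ^ (-((γ - 1) / 2)))
    (hc : ∀ x t, c x t = Kc * m x t * η x t ^ ((γ + 1) / (γ - 1)))
    (y q : ℝ → ℝ → ℝ)
    (hy : ∀ x t, y x t =
      m x t ^ (-(3 * (3 - γ) / (2 * (3 * γ - 1)))) * η x t ^ ((γ + 1) / (2 * (γ - 1)))
        * (pdx (fun x' t' => u x' t' + m x' t' * η x' t') x t
            - 2 / (3 * γ - 1) * pdx m x t * η x t))
    (hq : ∀ x t, q x t =
      m x t ^ (-(3 * (3 - γ) / (2 * (3 * γ - 1)))) * η x t ^ ((γ + 1) / (2 * (γ - 1)))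
        * (pdx (fun x' t' => u x' t' - m x' t' * η x' t') x t
            + 2 / (3 * γ - 1) * pdx m x t * η x t))
    (a0 a2 : ℝ → ℝ → ℝ)
    (ha0 : ∀ x t, a0 x t =
      Kc / γ * ((γ - 1) / (3 * γ - 1) * (m x t * pdx (pdx m) x t)
          - (3 * γ + 1) * (γ - 1) / (3 * γ - 1) ^ 2 * (pdx m x t) ^ 2)
        * m x t ^ (-(3 * (3 - γ) / (2 * (3 * γ - 1))))
        * η x t ^ (3 * (γ + 1) / (2 * (γ - 1)) + 1))
    (ha2 : ∀ x t, a2 x t =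
      -(Kc * ((γ + 1) / (2 * (γ - 1))) * m x t ^ (3 * (3 - γ) / (2 * (3 * γ - 1)))
        * η x t ^ ((γ + 1) / (2 * (γ - 1)) - 1))) :
    ∀ x t,
      (pdt y x t + c x t * pdx y x t = a0 x t + a2 x t * y x t ^ 2) ∧
      (pdt q x t - c x t * pdx q x t = a0 x t + a2 x t * q x t ^ 2) ∧
      a2 x t < 0 := by
  have hγ1 : 0 < γ - 1 := by linarith
  have hγ3 : 0 < 3 * γ - 1 := by linarith
  have hγ0 : 0 < γ := by linarith
  set s := Real.sqrt (K * γ) with hs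
  have hspos : 0 < s := Real.sqrt_pos.mpr (by positivity)
  have hs2 : s ^ 2 = K * γ := Real.sq_sqrt (by positivity)
  have hKtpos : 0 < Ktau := hKtau ▸ rpow_pos_of_pos (by positivity) _
  have hKcpos : 0 < Kc := hKc ▸ mul_pos hspos (rpow_pos_of_pos hKtpos _)
  have hmpos x t : 0 < m x t := hm x t ▸ Real.exp_pos _
  have hηpos x t : 0 < η x t :=
    hη x t ▸ mul_pos (by positivity) (rpow_pos_of_pos (hτpos x t) _)
  have hmreg : ContDiff ℝ 2 (fun z : ℝ × ℝ => m z.1 z.2) := by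
    simp only [hm]
    exact (hSreg.div_const _).exp
  have hηreg : ContDiff ℝ 2 (fun z : ℝ × ℝ => η z.1 z.2) := by
    simp only [hη]
    exact contDiff_const.mul (hτreg.rpow_const_of_ne fun z => (hτpos z.1 z.2).ne')
  have dτ := hτreg.differentiable two_ne_zero
  have du := hureg.differentiable two_ne_zero
  have dm := hmreg.differentiable two_ne_zero
  have dη := hηreg.differentiable two_ne_zero
  have hpm x t : p x t = K * m x t ^ 2 * τ x t ^ (-γ) := by
    rw [hp, hm, ← Real.exp_nat_mul]
    congr 3
    field_simp
    norm_num
  have hpx x t : pdx p x t = K * (2 * m x t * pdx m x t * τ x t ^ (-γ)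
      - m x t ^ 2 * γ * (τ x t ^ (-γ) / τ x t) * pdx τ x t) := by
    have h := pdx_eq_of_hasDerivAt ((((hasDerivAt_pdx dm x t).fun_pow 2).const_mul K).fun_mul
      ((hasDerivAt_pdx dτ x t).rpow_const (p := -γ) (Or.inl (hτpos x t).ne'))) (fun x' => hpm x' t)
    rw [h, rpow_sub_one (hτpos x t).ne']
    push_cast
    ring
  have hmt x t : pdt m x t = 0 := by
    have hT := hτpos x t
    have hM := hmpos x t
    have hpreg : DifferentiableAt ℝ (fun x' => p x' t) x := by
      simp only [hpm]
      exact ((((hasDerivAt_pdx dm x t).fun_pow 2).const_mul K).fun_mul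
        ((hasDerivAt_pdx dτ x t).rpow_const (p := -γ) (Or.inl hT.ne'))).differentiableAt
    have h1 := pdt_eq_of_hasDerivAt (f := fun x' t' => u x' t' ^ 2 / 2 + e x' t')
      ((((hasDerivAt_pdt du x t).fun_pow 2).div_const 2).fun_add
      ((((((hasDerivAt_pdt dm x t).fun_pow 2).const_mul K).fun_mul
      ((hasDerivAt_pdt dτ x t).rpow_const (p := -γ) (Or.inl hT.ne'))).fun_mul
        (hasDerivAt_pdt dτ x t)).div_const (γ - 1)))
      (fun t' => by rw [he, hpm])
    have h2 : pdx (fun x' t' => u x' t' * p x' t') x t = pdx u x t * p x t + u x t * pdx p x t :=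
      ((hasDerivAt_pdx du x t).fun_mul hpreg.hasDerivAt).deriv
    have hE := hen x t
    rw [h1, h2, rpow_sub_one hT.ne', hpm] at hE
    have hux : pdt τ x t = pdx u x t := by linarith [hmass x t]
    have hut : pdt u x t = -pdx p x t := by linarith [hmom x t]
    rw [hux, hut] at hE
    have hP : 0 < τ x t ^ (-γ) := rpow_pos_of_pos hT _
    have hne : 2 * K * m x t * τ x t ^ (-γ) * τ x t ≠ 0 := by positivity
    refine (mul_eq_zero.mp ?_).resolve_left hne
    field_simp at hE
    push_cast at hE
    linear_combination hE / 2
  have hk x t : Kc * η x t ^ ((γ + 1) / (γ - 1)) = s * τ x t ^ (-((γ + 1) / 2)) := by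
    have hA : 0 < 2 * s / (γ - 1) := by positivity
    rw [hKc, hKtau, hη, mul_rpow hA.le (rpow_pos_of_pos (hτpos x t) _).le, ← rpow_mul hA.le,
      ← rpow_mul (hτpos x t).le]
    have e1 : 2 / (γ - 1) * -((γ + 1) / 2) = -((γ + 1) / (γ - 1)) := by field_simp
    have e2 : -((γ - 1) / 2) * ((γ + 1) / (γ - 1)) = -((γ + 1) / 2) := by field_simp
    rw [e1, e2, rpow_neg hA.le]
    have := (rpow_pos_of_pos hA ((γ + 1) / (γ - 1))).ne'
    field_simp
  have hpow x t : τ x t ^ (-((γ - 1) / 2)) = τ x t ^ (-((γ + 1) / 2)) * τ x t := by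
    rw [← rpow_add_one (hτpos x t).ne']
    congr 1
    ring
  have hpow2 x t : τ x t ^ (-γ) = (τ x t ^ (-((γ + 1) / 2))) ^ 2 * τ x t := by
    rw [← rpow_natCast, ← rpow_mul (hτpos x t).le, ← rpow_add_one (hτpos x t).ne']
    congr 1
    push_cast
    ring
  have hηt x t : pdt η x t = -(Kc * η x t ^ ((γ + 1) / (γ - 1)) * pdx u x t) := by
    have hT := (hτpos x t).ne'
    rw [pdt_eq_of_hasDerivAt (((hasDerivAt_pdt dτ x t).rpow_const (p := -((γ - 1) / 2))
      (Or.inl hT)).const_mul (2 * s / (γ - 1))) (fun t' => hη x t'), hk, rpow_sub_one hT, hpow,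
      show pdt τ x t = pdx u x t by linarith [hmass x t]]
    field_simp
  have hηx x t : pdx η x t = -(s * τ x t ^ (-((γ + 1) / 2)) * pdx τ x t) := by
    have hT := (hτpos x t).ne'
    rw [pdx_eq_of_hasDerivAt (((hasDerivAt_pdx dτ x t).rpow_const (p := -((γ - 1) / 2))
      (Or.inl hT)).const_mul (2 * s / (γ - 1))) (fun x' => hη x' t), rpow_sub_one hT, hpow]
    field_simp
  have hut x t : pdt u x t = -(m x t * (Kc * η x t ^ ((γ + 1) / (γ - 1)))
      * ((γ - 1) / γ * (pdx m x t * η x t) + m x t * pdx η x t)) := by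
    have hT := (hτpos x t).ne'
    rw [show pdt u x t = -pdx p x t by linarith [hmom x t], hpx, hk, hηx, hη, hpow, hpow2,
      show K = s ^ 2 / γ by rw [hs2]; field_simp]
    field_simp
    ring
  have hpdx_mul x t : HasDerivAt (fun x' => m x' t * η x' t)
      (pdx m x t * η x t + m x t * pdx η x t) x :=
    (hasDerivAt_pdx dm x t).fun_mul (hasDerivAt_pdx dη x t)
  intro x t
  refine ⟨?_, ?_, ?_⟩
  · have h := riccati_of_characteristic_form (ε := 1) (y := y) hγ (by norm_num) hmreg hηreg hureg
      hmpos hηpos hmt hηt hut (fun x t => ?_) x t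
    · rw [hc, ha0, ha2, ← h]
      ring
    · rw [hy, pdx_eq_of_hasDerivAt (f := fun x' t' => u x' t' + m x' t' * η x' t')
        ((hasDerivAt_pdx du x t).fun_add (hpdx_mul x t)) fun _ => rfl]
      field_simp
      ring
  · have h := riccati_of_characteristic_form (ε := -1) (y := q) hγ (by norm_num) hmreg hηreg hureg
      hmpos hηpos hmt hηt hut (fun x t => ?_) x t
    · rw [hc, ha0, ha2, ← h]
      ring
    · rw [hq, pdx_eq_of_hasDerivAt (f := fun x' t' => u x' t' - m x' t' * η x' t')
        ((hasDerivAt_pdx du x t).fun_sub (hpdx_mul x t)) fun _ => rfl]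
      field_simp
      ring
  · have h1 := rpow_pos_of_pos (hmpos x t) (3 * (3 - γ) / (2 * (3 * γ - 1)))
    have h2 := rpow_pos_of_pos (hηpos x t) ((γ + 1) / (2 * (γ - 1)) - 1)
    rw [ha2, neg_lt_zero]
    positivity
end

section
/- Let N > 0, ε > 0, δ > 0 and T > 0. Suppose y : [0,T) → ℝ is differentiable and there are functions a₀, a₂ : [0,T) → ℝ with y'(t) = a₀(t) + a₂(t) y(t)², a₂(t) ≤ −δ, and a₀(t) ≤ −a₂(t) N² for all t ∈ [0,T), and suppose y(0) < −(1+ε) N. Then y(t) < −(1+ε)N for all t ∈ [0,T), y'(t) ≤ (1 − (1+ε)^{−2}) a₂(t) y(t)² < 0, and necessarily T ≤ 1/(δ (1 − (1+ε)^{−2}) (1+ε) N); in particular, no such y exists on [0,T) when T > 1/(δ (1 − (1+ε)^{−2}) (1+ε) N), i.e. y escapes to −∞ in finite time. -/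
open Real

/-- Algebraic bound on the right-hand side of the Riccati equation below the threshold. -/
lemma riccati_rhs_le {N r a b y : ℝ} (hN : 0 < N) (hr : 0 < r) (hb : b ≤ 0)
    (ha : a ≤ -b * N ^ 2) (hy : y < -r * N) :
    a + b * y ^ 2 ≤ (1 - r⁻¹ ^ 2) * (b * y ^ 2) := by
  have hrN : r * N ≤ -y := by linarith
  have hN' : N ≤ r⁻¹ * -y := by
    rw [inv_mul_eq_div, le_div_iff₀ hr]
    linarith
  have hsq : N ^ 2 ≤ r⁻¹ ^ 2 * y ^ 2 := by
    calc N ^ 2 ≤ (r⁻¹ * -y) ^ 2 := by gcongr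
      _ = r⁻¹ ^ 2 * y ^ 2 := by ring
  nlinarith [mul_le_mul_of_nonneg_left hsq (neg_nonneg.2 hb)]

/-- A differentiable function with `y' ≤ -K y²` and `y < 0` on `[0, t]` satisfies
`K t < -1 / y 0`. -/
lemma mul_lt_neg_inv_of_deriv_le_neg_mul_sq {y y' : ℝ → ℝ} {K t : ℝ} (ht : 0 ≤ t)
    (hc : ContinuousOn y (Set.Icc 0 t))
    (hd : ∀ x ∈ Set.Ico 0 t, HasDerivWithinAt y (y' x) (Set.Ici x) x)
    (hneg : ∀ x ∈ Set.Icc 0 t, y x < 0)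
    (hle : ∀ x ∈ Set.Ico 0 t, y' x ≤ -K * y x ^ 2) :
    K * t < -(y 0)⁻¹ := by
  have hB : ∀ x, HasDerivAt (fun x => -(y 0)⁻¹ - K * x) (-K) x := fun x => by
    simpa using ((hasDerivAt_id x).const_mul K).const_sub (-(y 0)⁻¹)
  have key : -(y t)⁻¹ ≤ -(y 0)⁻¹ - K * t :=
    image_le_of_deriv_right_le_deriv_boundary (f := fun x => -(y x)⁻¹)
      (f' := fun x => -(-y' x / y x ^ 2)) (B := fun x => -(y 0)⁻¹ - K * x) (B' := fun _ => -K)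
      (hc.inv₀ fun x hx => (hneg x hx).ne).neg
      (fun x hx => ((hd x hx).inv (hneg x (Set.Ico_subset_Icc_self hx)).ne).neg)
      (by simp) (fun x _ => (hB x).continuousAt.continuousWithinAt)
      (fun x _ => (hB x).hasDerivWithinAt)
      (fun x hx => by
        have h := hneg x (Set.Ico_subset_Icc_self hx)
        rw [neg_div, neg_neg, div_le_iff₀ (sq_pos_of_neg h)]
        exact hle x hx)
      (Set.right_mem_Icc.2 ht)
  have := inv_lt_zero.2 (hneg t (Set.right_mem_Icc.2 ht))
  linarith

/-- the Riccati-type blowup mechanism.  If `y' = a₀ + a₂ y²`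
with `a₂ ≤ -δ` and `a₀ ≤ -a₂ N²`, and `y(0) < -(1+ε)N`, then `y` stays below
`-(1+ε)N`, its derivative is negative and quadratically decreasing, and the
interval of existence satisfies `T ≤ 1/(δ (1-(1+ε)⁻²)(1+ε) N)`; in particular
`y` escapes to `-∞` in finite time. -/
theorem stmt10
    (N ε δ T : ℝ) (hN : 0 < N) (hε : 0 < ε) (hδ : 0 < δ) (hT : 0 < T)
    (y a0 a2 : ℝ → ℝ)
    (hy : ∀ t ∈ Set.Ico (0:ℝ) T,
      HasDerivWithinAt y (a0 t + a2 t * y t ^ 2) (Set.Ico (0:ℝ) T) t)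
    (ha2 : ∀ t ∈ Set.Ico (0:ℝ) T, a2 t ≤ -δ)
    (ha0 : ∀ t ∈ Set.Ico (0:ℝ) T, a0 t ≤ -(a2 t) * N ^ 2)
    (hy0 : y 0 < -(1 + ε) * N) :
    (∀ t ∈ Set.Ico (0:ℝ) T,
      y t < -(1 + ε) * N ∧
      a0 t + a2 t * y t ^ 2 ≤ (1 - (1 + ε)⁻¹ ^ 2) * (a2 t * y t ^ 2) ∧
      (1 - (1 + ε)⁻¹ ^ 2) * (a2 t * y t ^ 2) < 0) ∧
    T ≤ 1 / (δ * (1 - (1 + ε)⁻¹ ^ 2) * (1 + ε) * N) := by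
  have hr : 0 < 1 + ε := by linarith
  have hrN : 0 < (1 + ε) * N := mul_pos hr hN
  have hc : 0 < 1 - (1 + ε)⁻¹ ^ 2 := by
    have h1 : (1 + ε)⁻¹ < 1 := inv_lt_one_of_one_lt₀ (by linarith)
    have h0 : 0 < (1 + ε)⁻¹ := inv_pos.2 hr
    nlinarith
  have hbound : ∀ t ∈ Set.Ico (0:ℝ) T, y t < -(1 + ε) * N →
      a0 t + a2 t * y t ^ 2 ≤ (1 - (1 + ε)⁻¹ ^ 2) * (a2 t * y t ^ 2) ∧
      (1 - (1 + ε)⁻¹ ^ 2) * (a2 t * y t ^ 2) < 0 := fun t ht hyt => by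
    have h2 : a2 t < 0 := by linarith [ha2 t ht]
    have hyneg : y t < 0 := by linarith
    exact ⟨riccati_rhs_le hN hr h2.le (ha0 t ht) hyt,
      mul_neg_of_pos_of_neg hc (mul_neg_of_neg_of_pos h2 (sq_pos_of_neg hyneg))⟩
  have hright : ∀ t ∈ Set.Ico (0:ℝ) T,
      HasDerivWithinAt y (a0 t + a2 t * y t ^ 2) (Set.Ici t) t := fun t ht =>
    (hy t ht).mono_of_mem_nhdsWithin
      (Filter.mem_of_superset (Ico_mem_nhdsGE ht.2) (Set.Ico_subset_Ico_left ht.1))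
  have hcont : ContinuousOn y (Set.Ico 0 T) := fun t ht => (hy t ht).continuousWithinAt
  have hlt : ∀ t ∈ Set.Ico (0:ℝ) T, y t < -(1 + ε) * N := fun t ht => by
    have hsub : Set.Icc 0 t ⊆ Set.Ico 0 T := Set.Icc_subset_Ico_right ht.2
    refine lt_of_le_of_lt ?_ hy0
    exact image_le_of_deriv_right_lt_deriv_boundary (B := fun _ => y 0) (B' := fun _ => 0)
      (hcont.mono hsub) (fun x hx => hright x (hsub (Set.Ico_subset_Icc_self hx))) le_rfl
      (fun x => hasDerivAt_const x _)
      (fun x hx hxy => by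
        have h := hbound x (hsub (Set.Ico_subset_Icc_self hx)) (hxy.trans_lt hy0)
        exact h.1.trans_lt h.2)
      (Set.right_mem_Icc.2 ht.1)
  refine ⟨fun t ht => ⟨hlt t ht, hbound t ht (hlt t ht)⟩, ?_⟩
  refine le_of_forall_lt_imp_le_of_dense fun t htT => ?_
  rcases lt_or_ge t 0 with ht0 | ht0
  · exact ht0.le.trans (by positivity)
  have hsub : Set.Icc 0 t ⊆ Set.Ico 0 T := Set.Icc_subset_Ico_right htT
  have hK : δ * (1 - (1 + ε)⁻¹ ^ 2) * t < -(y 0)⁻¹ :=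
    mul_lt_neg_inv_of_deriv_le_neg_mul_sq ht0 (hcont.mono hsub)
      (fun x hx => hright x (hsub (Set.Ico_subset_Icc_self hx)))
      (fun x hx => by linarith [hlt x (hsub hx)])
      (fun x hx => by
        have hx' := hsub (Set.Ico_subset_Icc_self hx)
        refine (hbound x hx' (hlt x hx')).1.trans ?_
        nlinarith [mul_le_mul_of_nonneg_left (ha2 x hx') (mul_nonneg hc.le (sq_nonneg (y x)))])
  have hinv : -(y 0)⁻¹ ≤ ((1 + ε) * N)⁻¹ := by
    rw [← inv_neg]
    exact inv_anti₀ hrN (by linarith)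
  have hlast : δ * (1 - (1 + ε)⁻¹ ^ 2) * t * ((1 + ε) * N) ≤ 1 :=
    (le_mul_inv_iff₀ hrN).1 (by rw [one_mul]; exact hK.le.trans hinv)
  rw [le_div_iff₀ (by positivity)]
  linarith
end

section
/- Let (τ, u) be a C² solution of the generalized p-system τ_t − u_x = 0, u_t + P(τ,x)_x = 0 with P C³ in (τ,x), P_τ < 0, P_ττ > 0. Then the gradient variables y and q satisfy the Riccati equations ∂₊y = a₀ + a₁ y + a₂ y² and ∂₋q = a₀ − a₁ q + a₂ q², where a₀ = −c I_μ + (1/2)√c (P_μ/c)_h P_μ − c (P_μ/c)_h I − (c_h/(2√c)) I², a₁ = −c (P_μ/c)_h − (c_h/√c) I, and a₂ = −c_h/(2√c) < 0. -/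
open Real MeasureTheory

/-- derivative in the first (specific volume) variable of a function of `(τ, x)` -/
noncomputable def dV (g : ℝ → ℝ → ℝ) (v x : ℝ) : ℝ := deriv (fun v' => g v' x) v
/-- derivative in the second (space) variable of a function of `(τ, x)` -/
noncomputable def dX (g : ℝ → ℝ → ℝ) (v x : ℝ) : ℝ := deriv (fun x' => g v x') x

section Partials

variable {g g' : ℝ → ℝ → ℝ} {S : Set (ℝ × ℝ)} {v x : ℝ}

theorem hasDerivAt_comp_curve {α β : ℝ → ℝ} {α' β' s : ℝ}
    (hg : DifferentiableAt ℝ (fun w : ℝ × ℝ => g w.1 w.2) (α s, β s))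
    (hα : HasDerivAt α α' s) (hβ : HasDerivAt β β' s) :
    HasDerivAt (fun r => g (α r) (β r))
      (dV g (α s) (β s) * α' + dX g (α s) (β s) * β') s := by
  have key : ∀ {a b : ℝ → ℝ} {a' b' r : ℝ}, (a r, b r) = (α s, β s) →
      HasDerivAt a a' r → HasDerivAt b b' r →
      HasDerivAt (fun r => g (a r) (b r))
        (fderiv ℝ (fun w : ℝ × ℝ => g w.1 w.2) (α s, β s) (a', b')) r := by
    intro a b a' b' r hab ha hb
    have h1 := hg.hasFDerivAt
    rw [← hab] at h1 ⊢
    exact h1.comp_hasDerivAt r (ha.prodMk hb)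
  have e1 : dV g (α s) (β s) = fderiv ℝ (fun w : ℝ × ℝ => g w.1 w.2) (α s, β s) (1, 0) :=
    (key (a := fun r => r) (b := fun _ => β s) rfl (hasDerivAt_id (α s))
      (hasDerivAt_const (α s) (β s))).deriv
  have e2 : dX g (α s) (β s) = fderiv ℝ (fun w : ℝ × ℝ => g w.1 w.2) (α s, β s) (0, 1) :=
    (key (a := fun _ => α s) (b := fun r => r) rfl (hasDerivAt_const (β s) (α s))
      (hasDerivAt_id (β s))).deriv
  have h3 : ((α', β') : ℝ × ℝ) = α' • (1, 0) + β' • (0, 1) := by simp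
  have := key rfl hα hβ
  rw [h3, map_add, map_smul, map_smul, ← e1, ← e2] at this
  convert this using 1
  simp [mul_comm]

theorem hasDerivAt_dV (hg : DifferentiableAt ℝ (fun w : ℝ × ℝ => g w.1 w.2) (v, x)) :
    HasDerivAt (fun v' => g v' x) (dV g v x) v := by
  have := hasDerivAt_comp_curve (α := fun r => r) (β := fun _ => x) (s := v) hg
    (hasDerivAt_id v) (hasDerivAt_const v x)
  simpa using this

theorem hasDerivAt_dX (hg : DifferentiableAt ℝ (fun w : ℝ × ℝ => g w.1 w.2) (v, x)) :
    HasDerivAt (fun x' => g v x') (dX g v x) x := by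
  have := hasDerivAt_comp_curve (α := fun _ => v) (β := fun r => r) (s := x) hg
    (hasDerivAt_const x v) (hasDerivAt_id x)
  simpa using this

theorem dV_eq_fderiv (hg : DifferentiableAt ℝ (fun w : ℝ × ℝ => g w.1 w.2) (v, x)) :
    dV g v x = fderiv ℝ (fun w : ℝ × ℝ => g w.1 w.2) (v, x) (1, 0) := by
  have : HasDerivAt (fun v' => g v' x) (fderiv ℝ (fun w : ℝ × ℝ => g w.1 w.2) (v, x) (1, 0)) v :=
    HasFDerivAt.comp_hasDerivAt (f := fun v' => (v', x)) v hg.hasFDerivAt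
      ((hasDerivAt_id v).prodMk (hasDerivAt_const v x))
  exact this.deriv

theorem dX_eq_fderiv (hg : DifferentiableAt ℝ (fun w : ℝ × ℝ => g w.1 w.2) (v, x)) :
    dX g v x = fderiv ℝ (fun w : ℝ × ℝ => g w.1 w.2) (v, x) (0, 1) :=
  (hg.hasFDerivAt.comp_hasDerivAt x ((hasDerivAt_const x v).prodMk (hasDerivAt_id x))).deriv

theorem contDiffOn_dV (hS : IsOpen S) {m n : WithTop ℕ∞} (hmn : m + 1 ≤ n)
    (hg : ContDiffOn ℝ n (fun w : ℝ × ℝ => g w.1 w.2) S) :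
    ContDiffOn ℝ m (fun w : ℝ × ℝ => dV g w.1 w.2) S := by
  refine ((hg.fderiv_of_isOpen hS hmn).clm_apply
    (contDiffOn_const (c := ((1, 0) : ℝ × ℝ)))).congr fun w hw => ?_
  exact dV_eq_fderiv ((hg.differentiableOn (by rintro rfl; simp at hmn)).differentiableAt
    (hS.mem_nhds hw))

theorem contDiffOn_dX (hS : IsOpen S) {m n : WithTop ℕ∞} (hmn : m + 1 ≤ n)
    (hg : ContDiffOn ℝ n (fun w : ℝ × ℝ => g w.1 w.2) S) :
    ContDiffOn ℝ m (fun w : ℝ × ℝ => dX g w.1 w.2) S := by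
  refine ((hg.fderiv_of_isOpen hS hmn).clm_apply
    (contDiffOn_const (c := ((0, 1) : ℝ × ℝ)))).congr fun w hw => ?_
  exact dX_eq_fderiv ((hg.differentiableOn (by rintro rfl; simp at hmn)).differentiableAt
    (hS.mem_nhds hw))

theorem dV_congr (hS : IsOpen S) (hvx : (v, x) ∈ S)
    (hgg : ∀ w ∈ S, g w.1 w.2 = g' w.1 w.2) : dV g v x = dV g' v x := by
  refine Filter.EventuallyEq.deriv_eq ?_
  have : Continuous fun v' : ℝ => (v', x) := by fun_prop
  filter_upwards [(hS.preimage this).mem_nhds hvx] with v' hv' using hgg _ hv'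

theorem dX_congr (hS : IsOpen S) (hvx : (v, x) ∈ S)
    (hgg : ∀ w ∈ S, g w.1 w.2 = g' w.1 w.2) : dX g v x = dX g' v x := by
  refine Filter.EventuallyEq.deriv_eq ?_
  have : Continuous fun x' : ℝ => (v, x') := by fun_prop
  filter_upwards [(hS.preimage this).mem_nhds hvx] with x' hx' using hgg _ hx'

theorem dV_dX_comm (hS : IsOpen S) (hvx : (v, x) ∈ S)
    (hg : ContDiffOn ℝ 2 (fun w : ℝ × ℝ => g w.1 w.2) S) :
    dV (dX g) v x = dX (dV g) v x := by
  set f : ℝ × ℝ → ℝ := fun w => g w.1 w.2 with hf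
  have hd : ∀ w ∈ S, DifferentiableAt ℝ f w := fun w hw =>
    (hg.differentiableOn (by norm_num)).differentiableAt (hS.mem_nhds hw)
  have hf' : DifferentiableAt ℝ (fderiv ℝ f) (v, x) :=
    ((hg.fderiv_of_isOpen hS (m := 1) (by norm_num)).differentiableOn
      (by norm_num)).differentiableAt (hS.mem_nhds hvx)
  have hap : ∀ e : ℝ × ℝ, HasFDerivAt (fun w => fderiv ℝ f w e)
      ((fderiv ℝ (fderiv ℝ f) (v, x)).flip e) (v, x) := fun e => by
    simpa using hf'.hasFDerivAt.clm_apply (hasFDerivAt_const e (v, x))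
  have hsymm : IsSymmSndFDerivAt ℝ f (v, x) :=
    (hg.contDiffAt (hS.mem_nhds hvx)).isSymmSndFDerivAt (by simp)
  have e1 : dV (dX g) v x = fderiv ℝ (fderiv ℝ f) (v, x) (1, 0) (0, 1) := by
    rw [dV_congr (g' := fun a b => fderiv ℝ f (a, b) (0, 1)) hS hvx
      fun w hw => dX_eq_fderiv (hd w hw)]
    rw [dV_eq_fderiv (hap (0, 1)).differentiableAt]
    rw [(hap (0, 1)).fderiv]
    rfl
  have e2 : dX (dV g) v x = fderiv ℝ (fderiv ℝ f) (v, x) (0, 1) (1, 0) := by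
    rw [dX_congr (g' := fun a b => fderiv ℝ f (a, b) (1, 0)) hS hvx
      fun w hw => dV_eq_fderiv (hd w hw)]
    rw [dX_eq_fderiv (hap (1, 0)).differentiableAt]
    rw [(hap (1, 0)).fderiv]
    rfl
  rw [e1, e2]
  exact hsymm _ _

end Partials

theorem differentiableAt_parametric_integral {Φ : (ℝ × ℝ) × ℝ → ℝ} {S : Set ((ℝ × ℝ) × ℝ)}
    (hS : IsOpen S) (hΦ : ContDiffOn ℝ 1 Φ S) {p : ℝ × ℝ}
    (hp : ∀ s ∈ Set.Icc (0 : ℝ) 1, (p, s) ∈ S) :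
    DifferentiableAt ℝ (fun p => ∫ s in (0 : ℝ)..1, Φ (p, s)) p := by
  have hcont : ContinuousOn (fderiv ℝ Φ) S := hΦ.continuousOn_fderiv_of_isOpen hS le_rfl
  have hline : Continuous fun s : ℝ => (p, s) := by fun_prop
  obtain ⟨M, hM⟩ := isCompact_Icc.exists_bound_of_continuousOn
    (hcont.comp hline.continuousOn hp)
  set W : Set ((ℝ × ℝ) × ℝ) := S ∩ (fun z => ‖fderiv ℝ Φ z‖) ⁻¹' Set.Iio (M + 1) with hW
  have hWo : IsOpen W := hcont.norm.isOpen_inter_preimage hS isOpen_Iio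
  obtain ⟨A, B, hA, -, hpA, hIB, hAB⟩ := generalized_tube_lemma (isCompact_singleton (x := p))
    (isCompact_Icc (a := (0 : ℝ)) (b := 1)) hWo (by
      rintro ⟨p', s⟩ ⟨hp', hs⟩
      obtain rfl : p' = p := hp'
      refine ⟨hp s hs, ?_⟩
      have := hM s hs
      simp only [Function.comp] at this
      simp only [Set.mem_preimage, Set.mem_Iio]
      linarith)
  have hmem : ∀ p' ∈ A, ∀ s ∈ Set.Icc (0 : ℝ) 1, (p', s) ∈ W := fun p' hp' s hs =>
    hAB ⟨hp', hIB hs⟩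
  have hAn : A ∈ nhds p := hA.mem_nhds (hpA rfl)
  have hsub : Set.uIoc (0 : ℝ) 1 ⊆ Set.Icc 0 1 := by
    rw [Set.uIoc_of_le zero_le_one]; exact Set.Ioc_subset_Icc_self
  have hΦc : ∀ p' ∈ A, ContinuousOn (fun s => Φ (p', s)) (Set.Icc 0 1) := fun p' hp' =>
    hΦ.continuousOn.comp (by fun_prop) fun s hs => (hmem p' hp' s hs).1
  refine (intervalIntegral.hasFDerivAt_integral_of_dominated_of_fderiv_le (μ := volume)
    (F := fun p s => Φ (p, s)) (bound := fun _ => (M + 1) * ‖ContinuousLinearMap.inl ℝ (ℝ × ℝ) ℝ‖)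
    (F' := fun p s => (fderiv ℝ Φ (p, s)).comp (ContinuousLinearMap.inl ℝ (ℝ × ℝ) ℝ))
    hAn ?_ ?_ ?_ ?_ ?_ ?_).differentiableAt
  · filter_upwards [hAn] with p' hp'
    exact ((hΦc p' hp').mono hsub).aestronglyMeasurable measurableSet_uIoc
  · exact ContinuousOn.intervalIntegrable (by
      rw [Set.uIcc_of_le zero_le_one]; exact hΦc p (hpA rfl))
  · refine ContinuousOn.aestronglyMeasurable ?_ measurableSet_uIoc
    exact ((hcont.comp hline.continuousOn hp).mono hsub).clm_comp continuousOn_const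
  · refine Filter.Eventually.of_forall fun s hs p' hp' => ?_
    refine (ContinuousLinearMap.opNorm_comp_le _ _).trans ?_
    gcongr
    exact (hmem p' hp' s (hsub hs)).2.le
  · exact intervalIntegrable_const
  · refine Filter.Eventually.of_forall fun s hs p' hp' => ?_
    have h1 := ((hΦ.differentiableOn one_ne_zero).differentiableAt
      (hS.mem_nhds (hmem p' hp' s (hsub hs)).1)).hasFDerivAt
    exact h1.comp p' (hasFDerivAt_prodMk_left p' s)

theorem differentiableAt_integral_of_contDiffOn {f : ℝ → ℝ → ℝ} {S : Set (ℝ × ℝ)}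
    (hS : IsOpen S) (hf : ContDiffOn ℝ 1 (fun w : ℝ × ℝ => f w.1 w.2) S) {a₀ a x : ℝ}
    (hx : ∀ b ∈ Set.uIcc a₀ a, (b, x) ∈ S) :
    DifferentiableAt ℝ (fun w : ℝ × ℝ => ∫ b in a₀..w.1, f b w.2) (a, x) := by
  have hmap : ContDiff ℝ 1 fun z : (ℝ × ℝ) × ℝ => ((a₀ + z.2 * (z.1.1 - a₀), z.1.2) : ℝ × ℝ) := by
    fun_prop
  have h1 := differentiableAt_parametric_integral (p := (a, x)) (hS.preimage hmap.continuous)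
    (hf.comp hmap.contDiffOn fun z hz => hz) (by
      intro s hs
      refine hx _ ?_
      rw [← segment_eq_uIcc, segment_eq_image']
      exact ⟨s, hs, by simp⟩)
  have h2 : (fun w : ℝ × ℝ => ∫ b in a₀..w.1, f b w.2) = fun w : ℝ × ℝ =>
      (w.1 - a₀) * ∫ s in (0 : ℝ)..1, f (a₀ + s * (w.1 - a₀)) w.2 := by
    funext w
    have := intervalIntegral.mul_integral_comp_add_mul (a := 0) (b := 1)
      (f := fun b => f b w.2) (w.1 - a₀) a₀
    simp only [mul_comm (w.1 - a₀) (_ : ℝ)] at this ⊢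
    simpa using this.symm
  rw [h2]
  exact (by fun_prop : DifferentiableAt ℝ (fun w : ℝ × ℝ => w.1 - a₀) (a, x)).mul h1

theorem contDiffAt_fiber_inverse {h T : ℝ → ℝ → ℝ} {n : WithTop ℕ∞} (hn : n ≠ 0)
    (hreg : ContDiffOn ℝ n (fun w : ℝ × ℝ => h w.1 w.2) (Set.Ioi 0 ×ˢ Set.univ))
    (hT : ∀ v > (0 : ℝ), ∀ x, T (h v x) x = v) {v x : ℝ} (hv : 0 < v) (hne : dV h v x ≠ 0) :
    ContDiffAt ℝ n (fun w : ℝ × ℝ => T w.1 w.2) (h v x, x) ∧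
      ∀ᶠ w : ℝ × ℝ in nhds (h v x, x), ∃ v' > (0 : ℝ), h v' w.2 = w.1 := by
  have hU : IsOpen (Set.Ioi (0 : ℝ) ×ˢ (Set.univ : Set ℝ)) := isOpen_Ioi.prod isOpen_univ
  have hvx : ((v, x) : ℝ × ℝ) ∈ Set.Ioi (0 : ℝ) ×ˢ (Set.univ : Set ℝ) := ⟨hv, trivial⟩
  have hat : ContDiffAt ℝ n (fun w : ℝ × ℝ => h w.1 w.2) (v, x) :=
    hreg.contDiffAt (hU.mem_nhds hvx)
  have hd := hat.differentiableAt hn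
  set p := dV h v x with hp
  set r := dX h v x with hr
  let A : (ℝ × ℝ) ≃L[ℝ] (ℝ × ℝ) := ContinuousLinearEquiv.equivOfInverse
    ((p • ContinuousLinearMap.fst ℝ ℝ ℝ + r • ContinuousLinearMap.snd ℝ ℝ ℝ).prod
      (ContinuousLinearMap.snd ℝ ℝ ℝ))
    ((p⁻¹ • (ContinuousLinearMap.fst ℝ ℝ ℝ - r • ContinuousLinearMap.snd ℝ ℝ ℝ)).prod
      (ContinuousLinearMap.snd ℝ ℝ ℝ))
    (fun z => by ext <;> simp [hne]) (fun z => by ext <;> simp [hne])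
  have hfd : fderiv ℝ (fun w : ℝ × ℝ => h w.1 w.2) (v, x) =
      p • ContinuousLinearMap.fst ℝ ℝ ℝ + r • ContinuousLinearMap.snd ℝ ℝ ℝ := by
    ext <;> simp [hp, hr, dV_eq_fderiv hd, dX_eq_fderiv hd]
  have hΦ : ContDiffAt ℝ n (fun w : ℝ × ℝ => ((h w.1 w.2, w.2) : ℝ × ℝ)) (v, x) :=
    hat.prodMk contDiffAt_snd
  have hΦ' : HasFDerivAt (fun w : ℝ × ℝ => ((h w.1 w.2, w.2) : ℝ × ℝ))
      (A : (ℝ × ℝ) →L[ℝ] (ℝ × ℝ)) (v, x) := by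
    have := hd.hasFDerivAt.prodMk (hasFDerivAt_snd (𝕜 := ℝ) (p := (v, x)))
    rw [hfd] at this
    exact this
  have hstrict := hΦ.hasStrictFDerivAt' hΦ' hn
  have hinv := hΦ.to_localInverse hΦ' hn
  have hright := hstrict.eventually_right_inverse
  have hpos : ∀ᶠ w in nhds ((h v x, x) : ℝ × ℝ), 0 < (hΦ.localInverse hΦ' hn w).1 := by
    refine (continuous_fst.continuousAt.comp hinv.continuousAt).eventually_const_lt ?_
    simp only [Function.comp]
    rw [hΦ.localInverse_apply_image hΦ' hn]
    exact hv
  have hev : ∀ᶠ w in nhds ((h v x, x) : ℝ × ℝ),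
      0 < (hΦ.localInverse hΦ' hn w).1 ∧ h (hΦ.localInverse hΦ' hn w).1 w.2 = w.1 := by
    filter_upwards [hright, hpos] with w hw hw0
    change ((h (hΦ.localInverse hΦ' hn w).1 (hΦ.localInverse hΦ' hn w).2,
      (hΦ.localInverse hΦ' hn w).2) : ℝ × ℝ) = w at hw
    have h1 := congrArg Prod.fst hw
    have h2 := congrArg Prod.snd hw
    simp only at h1 h2
    rw [h2] at h1
    exact ⟨hw0, h1⟩
  refine ⟨(contDiffAt_fst.comp _ hinv).congr_of_eventuallyEq ?_, ?_⟩
  · filter_upwards [hev] with w hw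
    have := hT _ hw.1 w.2
    rw [hw.2] at this
    exact this
  · filter_upwards [hev] with w hw using ⟨_, hw⟩

theorem differentiableAt_integral_fiber_inverse {h T k J : ℝ → ℝ → ℝ} {h₀ : ℝ}
    (hreg : ContDiffOn ℝ 1 (fun w : ℝ × ℝ => h w.1 w.2) (Set.Ioi 0 ×ˢ Set.univ))
    (hne : ∀ v > (0 : ℝ), ∀ x, dV h v x ≠ 0)
    (hT : ∀ v > (0 : ℝ), ∀ x, T (h v x) x = v)
    (hh₀ : ∀ x, ∃ v > (0 : ℝ), h v x = h₀)
    (hk : ContDiffOn ℝ 1 (fun w : ℝ × ℝ => k w.1 w.2) (Set.Ioi 0 ×ˢ Set.univ))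
    (hJ : ∀ a x, J a x = ∫ b in h₀..a, k (T b x) x) {v x : ℝ} (hv : 0 < v) :
    DifferentiableAt ℝ (fun w : ℝ × ℝ => J w.1 w.2) (h v x, x) ∧
      dV J (h v x) x = k v x := by
  have hU : IsOpen (Set.Ioi (0 : ℝ) ×ˢ (Set.univ : Set ℝ)) := isOpen_Ioi.prod isOpen_univ
  set S : Set (ℝ × ℝ) := {w | ∃ v > (0 : ℝ), h v w.2 = w.1} with hSdef
  have hS : IsOpen S := by
    rw [isOpen_iff_eventually]
    rintro ⟨b, z⟩ ⟨v', hv', hb⟩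
    obtain rfl : h v' z = b := hb
    exact (contDiffAt_fiber_inverse one_ne_zero hreg hT hv' (hne v' hv' z)).2
  have hf : ContDiffOn ℝ 1 (fun w : ℝ × ℝ => k (T w.1 w.2) w.2) S := by
    rintro ⟨b, z⟩ ⟨v', hv', hb⟩
    obtain rfl : h v' z = b := hb
    have h1 := (contDiffAt_fiber_inverse one_ne_zero hreg hT hv' (hne v' hv' z)).1
    have h2 : ContDiffAt ℝ 1 (fun w : ℝ × ℝ => k w.1 w.2) (T (h v' z) z, z) := by
      rw [hT v' hv' z]
      exact hk.contDiffAt (hU.mem_nhds ⟨hv', trivial⟩)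
    exact (ContDiffAt.comp (f := fun w : ℝ × ℝ => (T w.1 w.2, w.2)) (h v' z, z) h2
      (h1.prodMk contDiffAt_snd)).contDiffWithinAt
  have hmem : ∀ b ∈ Set.uIcc h₀ (h v x), (b, x) ∈ S := by
    have hcont : ContinuousOn (fun v' => h v' x) (Set.Ioi 0) :=
      hreg.continuousOn.comp (f := fun v' : ℝ => (v', x)) (by fun_prop) fun v' hv' => ⟨hv', trivial⟩
    have hconn := (isPreconnected_Ioi.image _ hcont).ordConnected
    obtain ⟨v₀, hv₀, hv₀'⟩ := hh₀ x
    intro b hb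
    obtain ⟨v', hv', hb'⟩ := hconn.uIcc_subset ⟨v₀, hv₀, hv₀'⟩ ⟨v, hv, rfl⟩ hb
    exact ⟨v', hv', hb'⟩
  have hJ' : (fun w : ℝ × ℝ => J w.1 w.2) =
      fun w : ℝ × ℝ => ∫ b in h₀..w.1, k (T b w.2) w.2 := funext fun w => hJ _ _
  refine ⟨?_, ?_⟩
  · rw [hJ']
    exact differentiableAt_integral_of_contDiffOn (f := fun b z => k (T b z) z) hS hf hmem
  · have hline : ContinuousOn (fun b => k (T b x) x) {b | (b, x) ∈ S} :=
      hf.continuousOn.comp (f := fun b : ℝ => (b, x)) (by fun_prop) fun b hb => hb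
    have hSx : IsOpen {b | (b, x) ∈ S} :=
      hS.preimage (by fun_prop : Continuous fun b : ℝ => (b, x))
    have hvS : h v x ∈ {b | (b, x) ∈ S} := ⟨v, hv, rfl⟩
    have hd := intervalIntegral.integral_hasDerivAt_right
      (hline.mono hmem).intervalIntegrable
      (hline.stronglyMeasurableAtFilter hSx _ hvS)
      (hline.continuousAt (hSx.mem_nhds hvS))
    have : (fun a => J a x) = fun a => ∫ b in h₀..a, k (T b x) x := funext fun a => hJ a x
    rw [dV, this, hd.deriv, hT v hv x]

theorem riccati_along_characteristic {ε : ℝ} (hε : ε = 1 ∨ ε = -1)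
    {c h M J τ u Y : ℝ → ℝ → ℝ}
    (hcpos : ∀ v > (0 : ℝ), ∀ x, 0 < c v x)
    (hcreg : ContDiffOn ℝ 1 (fun w : ℝ × ℝ => c w.1 w.2) (Set.Ioi 0 ×ˢ Set.univ))
    (hMreg : ContDiffOn ℝ 1 (fun w : ℝ × ℝ => M w.1 w.2) (Set.Ioi 0 ×ˢ Set.univ))
    (hhreg : ContDiffOn ℝ 2 (fun w : ℝ × ℝ => h w.1 w.2) (Set.Ioi 0 ×ˢ Set.univ))
    (hhv : ∀ v > (0 : ℝ), ∀ x, dV h v x = -(c v x))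
    (hMv : ∀ v > (0 : ℝ), ∀ x, dV M v x = -(dV c v x) * dX h v x - c v x * dX c v x)
    (hJ : ∀ v > (0 : ℝ), ∀ x, DifferentiableAt ℝ (fun w : ℝ × ℝ => J w.1 w.2) (h v x, x))
    (hJa : ∀ v > (0 : ℝ), ∀ x, dV J (h v x) x = 1 / 2 * √(c v x) *
      (-((dV M v x * c v x - M v x * dV c v x) / c v x ^ 2) / c v x))
    (hτreg : ContDiff ℝ 2 (fun w : ℝ × ℝ => τ w.1 w.2))
    (hureg : ContDiff ℝ 2 (fun w : ℝ × ℝ => u w.1 w.2))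
    (hτpos : ∀ x t, 0 < τ x t)
    (hmass : ∀ x t, pdt τ x t = pdx u x t)
    (hmom : ∀ x t, pdt u x t + c (τ x t) x *
      (-(c (τ x t) x) * pdx τ x t + dX h (τ x t) x) + M (τ x t) x = 0)
    (hY : ∀ x t, Y x t =
      √(c (τ x t) x) * pdx (fun x' t' => u x' t' + ε * h (τ x' t') x') x t
        + ε * (M (τ x t) x / √(c (τ x t) x) - J (h (τ x t) x) x))
    (x t : ℝ) {v : ℝ} (hvt : τ x t = v) :
    pdt Y x t + ε * c v x * pdx Y x t =
      (-(c v x) * dX J (h v x) x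
        + 1 / 2 * √(c v x) *
          (-((dV M v x * c v x - M v x * dV c v x) / c v x ^ 2) / c v x) * M v x
        - c v x * (-((dV M v x * c v x - M v x * dV c v x) / c v x ^ 2) / c v x) * J (h v x) x
        - -(dV c v x) / c v x / (2 * √(c v x)) * (J (h v x) x) ^ 2)
      + ε * (-(c v x) * (-((dV M v x * c v x - M v x * dV c v x) / c v x ^ 2) / c v x)
          - -(dV c v x) / c v x / √(c v x) * J (h v x) x) * Y x t
      + -(-(dV c v x) / c v x) / (2 * √(c v x)) * Y x t ^ 2 := by
  have hU : IsOpen (Set.Ioi (0 : ℝ) ×ˢ (Set.univ : Set ℝ)) := isOpen_Ioi.prod isOpen_univ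
  have hdiff : ∀ {g : ℝ → ℝ → ℝ}, ContDiffOn ℝ 1 (fun w : ℝ × ℝ => g w.1 w.2)
      (Set.Ioi 0 ×ˢ Set.univ) → ∀ x t,
      DifferentiableAt ℝ (fun w : ℝ × ℝ => g w.1 w.2) (τ x t, x) := fun hg x t =>
    (hg.differentiableOn one_ne_zero).differentiableAt (hU.mem_nhds ⟨hτpos x t, trivial⟩)
  have hx : ∀ {g : ℝ → ℝ → ℝ}, ContDiff ℝ 2 (fun w : ℝ × ℝ => g w.1 w.2) → ∀ x t,
      HasDerivAt (fun x' => g x' t) (pdx g x t) x := fun hg x t =>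
    hasDerivAt_dV (hg.differentiable (by norm_num) (x, t))
  have ht : ∀ {g : ℝ → ℝ → ℝ}, ContDiff ℝ 2 (fun w : ℝ × ℝ => g w.1 w.2) → ∀ x t,
      HasDerivAt (fun t' => g x t') (pdt g x t) t := fun hg x t =>
    hasDerivAt_dX (hg.differentiable (by norm_num) (x, t))
  have hgx : ∀ {g : ℝ → ℝ → ℝ}, ContDiffOn ℝ 1 (fun w : ℝ × ℝ => g w.1 w.2)
      (Set.Ioi 0 ×ˢ Set.univ) → ∀ x t, HasDerivAt (fun x' => g (τ x' t) x')
        (dV g (τ x t) x * pdx τ x t + dX g (τ x t) x) x := fun hg x t => by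
    simpa using hasDerivAt_comp_curve (α := fun x' => τ x' t) (β := fun x' => x') (hdiff hg x t)
      (hx hτreg x t) (hasDerivAt_id x)
  have hgt : ∀ {g : ℝ → ℝ → ℝ}, ContDiffOn ℝ 1 (fun w : ℝ × ℝ => g w.1 w.2)
      (Set.Ioi 0 ×ˢ Set.univ) → ∀ x t, HasDerivAt (fun t' => g (τ x t') x)
        (dV g (τ x t) x * pdt τ x t) t := fun hg x t => by
    simpa using hasDerivAt_comp_curve (α := fun t' => τ x t') (β := fun _ => x) (hdiff hg x t)
      (ht hτreg x t) (hasDerivAt_const t x)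
  have hh1 := hhreg.of_le (m := 1) (by norm_num)
  set w : ℝ → ℝ → ℝ := fun x' t' => u x' t' + ε * h (τ x' t') x' with hw
  have hwreg : ContDiff ℝ 2 (fun z : ℝ × ℝ => w z.1 z.2) := by
    refine hureg.add (contDiff_const.mul ?_)
    exact hhreg.comp_contDiff (hτreg.prodMk contDiff_fst) fun z => ⟨hτpos _ _, trivial⟩
  have hwx : ∀ x t, pdx w x t =
      pdx u x t + ε * (-(c (τ x t) x) * pdx τ x t + dX h (τ x t) x) := fun x t => by
    rw [← hhv _ (hτpos x t)]
    exact ((hx hureg x t).add ((hgx hh1 x t).const_mul ε)).deriv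
  have hwt : ∀ x t, pdt w x t = -(ε * c (τ x t) x * pdx w x t + M (τ x t) x) := fun x t => by
    have h1 : pdt w x t = pdt u x t + ε * (-(c (τ x t) x) * pdt τ x t) := by
      rw [← hhv _ (hτpos x t)]
      exact ((ht hureg x t).add ((hgt hh1 x t).const_mul ε)).deriv
    rw [h1, hwx, hmass]
    have := hmom x t
    rcases hε with rfl | rfl <;> linear_combination this
  have hwxd : DifferentiableAt ℝ (fun z : ℝ × ℝ => pdx w z.1 z.2) (x, t) :=
    ((contDiffOn_dV (m := 1) isOpen_univ (by norm_num) hwreg.contDiffOn).differentiableOn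
      one_ne_zero).differentiableAt Filter.univ_mem
  have hwxx : HasDerivAt (fun x' => pdx w x' t) (pdx (pdx w) x t) x := hasDerivAt_dV hwxd
  have hwxt : HasDerivAt (fun t' => pdx w x t') (pdt (pdx w) x t) t := hasDerivAt_dX hwxd
  have hcomm : pdt (pdx w) x t = pdx (pdt w) x t :=
    (dV_dX_comm isOpen_univ (Set.mem_univ (x, t)) hwreg.contDiffOn).symm
  have hwtx := (((hgx hcreg x t).const_mul ε).mul hwxx).add (hgx hMreg x t) |>.neg.deriv
  have hwtx' : pdt (pdx w) x t = -(ε * (dV c (τ x t) x * pdx τ x t + dX c (τ x t) x) * pdx w x t +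
      ε * c (τ x t) x * pdx (pdx w) x t + (dV M (τ x t) x * pdx τ x t + dX M (τ x t) x)) := by
    rw [hcomm, ← hwtx]
    exact congrArg (fun f => deriv f x) (funext fun x' => hwt x' t)
  rw [hwtx'] at hwxt
  have hv : 0 < v := hvt ▸ hτpos x t
  have hc0 := hcpos _ (hτpos x t) x
  have hs0 : 0 < √(c (τ x t) x) := Real.sqrt_pos.mpr hc0
  have hJx : HasDerivAt (fun x' => J (h (τ x' t) x') x') _ x :=
    hasDerivAt_comp_curve (α := fun x' => h (τ x' t) x') (β := fun x' => x')
      (hJ _ (hτpos x t) x) (hgx hh1 x t) (hasDerivAt_id x)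
  have hJt : HasDerivAt (fun t' => J (h (τ x t') x) x) _ t :=
    hasDerivAt_comp_curve (α := fun t' => h (τ x t') x) (β := fun _ => x)
      (hJ _ (hτpos x t) x) (hgt hh1 x t) (hasDerivAt_const t x)
  have hYx := ((((hgx hcreg x t).sqrt hc0.ne').mul hwxx).add
    ((((hgx hMreg x t).div ((hgx hcreg x t).sqrt hc0.ne') hs0.ne').sub hJx).const_mul ε)).deriv
  have hYt := ((((hgt hcreg x t).sqrt hc0.ne').mul hwxt).add
    ((((hgt hMreg x t).div ((hgt hcreg x t).sqrt hc0.ne') hs0.ne').sub hJt).const_mul ε)).deriv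
  have eYx : pdx Y x t = _ := (congrArg (fun f => deriv f x) (funext fun x' => hY x' t)).trans hYx
  have eYt : pdt Y x t = _ := (congrArg (fun f => deriv f t) (funext fun t' => hY x t')).trans hYt
  rw [eYx, eYt, hY x t, hJa _ (hτpos x t), hhv _ (hτpos x t), hmass x t, hwx x t, hvt,
    hMv v hv]
  rw [hvt] at hs0
  have hsq : c v x = √(c v x) ^ 2 := (Real.sq_sqrt (hcpos v hv x).le).symm
  generalize √(c v x) = s at hs0 hsq ⊢
  rw [hsq]
  generalize pdx (pdx w) x t = wxx
  generalize pdx u x t = ux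
  generalize pdx τ x t = τx
  generalize dV c v x = cv
  generalize dX c v x = cx
  generalize dX M v x = Mx
  generalize M v x = m
  generalize dX h v x = hX
  generalize J (h v x) x = j
  generalize dX J (h v x) x = jx
  clear * - hε hs0
  rcases hε with rfl | rfl
  · field_simp
    ring
  · field_simp
    ring

/-- for C² solutions of the generalized p-system, the gradient
variables `y` and `q` satisfy the Riccati equations
`∂₊y = a₀ + a₁ y + a₂ y²` and `∂₋q = a₀ − a₁ q + a₂ q²`, with `a₂ < 0`. -/
theorem stmt11
    (P : ℝ → ℝ → ℝ)
    (hPreg : ContDiffOn ℝ 3 (fun w : ℝ × ℝ => P w.1 w.2) (Set.Ioi 0 ×ˢ Set.univ))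
    (hPv : ∀ v > (0:ℝ), ∀ x, dV P v x < 0)
    (hPvv : ∀ v > (0:ℝ), ∀ x, 0 < dV (dV P) v x)
    (c : ℝ → ℝ → ℝ) (hc : ∀ v x, c v x = Real.sqrt (-(dV P v x)))
    (h : ℝ → ℝ → ℝ)
    (hhreg : ContDiffOn ℝ 3 (fun w : ℝ × ℝ => h w.1 w.2) (Set.Ioi 0 ×ˢ Set.univ))
    (hhv : ∀ v > (0:ℝ), ∀ x, dV h v x = -(c v x))
    (h0 : ℝ) (T : ℝ → ℝ → ℝ)
    (hT : ∀ v > (0:ℝ), ∀ x, T (h v x) x = v)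
    (hh0 : ∀ x, ∃ v > (0:ℝ), h v x = h0)
    (Pmu G J cH : ℝ → ℝ → ℝ)
    (hPmu : ∀ v x, Pmu v x = -(c v x) * dX h v x + dX P v x)
    (hG : ∀ v x, G v x = -(dV (fun v' x' => Pmu v' x' / c v' x') v x) / c v x)
    (hJ : ∀ a x, J a x = ∫ b in h0..a,
      1 / 2 * Real.sqrt (c (T b x) x) * G (T b x) x)
    (hcH : ∀ v x, cH v x = -(dV c v x) / c v x)
    (τ u : ℝ → ℝ → ℝ)
    (hτreg : ContDiff ℝ 2 (fun w : ℝ × ℝ => τ w.1 w.2))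
    (hureg : ContDiff ℝ 2 (fun w : ℝ × ℝ => u w.1 w.2))
    (hτpos : ∀ x t, 0 < τ x t)
    (hmass : ∀ x t, pdt τ x t - pdx u x t = 0)
    (hmom : ∀ x t, pdt u x t + pdx (fun x' t' => P (τ x' t') x') x t = 0)
    (y q : ℝ → ℝ → ℝ)
    (hy : ∀ x t, y x t =
      Real.sqrt (c (τ x t) x) * pdx (fun x' t' => u x' t' + h (τ x' t') x') x t
        + Pmu (τ x t) x / Real.sqrt (c (τ x t) x) - J (h (τ x t) x) x)
    (hq : ∀ x t, q x t =
      Real.sqrt (c (τ x t) x) * pdx (fun x' t' => u x' t' - h (τ x' t') x') x t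
        - Pmu (τ x t) x / Real.sqrt (c (τ x t) x) + J (h (τ x t) x) x)
    (a0 a1 a2 : ℝ → ℝ → ℝ)
    (ha0 : ∀ v x, a0 v x =
      -(c v x) * dX J (h v x) x
        + 1 / 2 * Real.sqrt (c v x) * G v x * Pmu v x
        - c v x * G v x * J (h v x) x
        - cH v x / (2 * Real.sqrt (c v x)) * (J (h v x) x) ^ 2)
    (ha1 : ∀ v x, a1 v x =
      -(c v x) * G v x - cH v x / Real.sqrt (c v x) * J (h v x) x)
    (ha2 : ∀ v x, a2 v x = -(cH v x) / (2 * Real.sqrt (c v x))) :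
    ∀ x t,
      (pdt y x t + c (τ x t) x * pdx y x t
        = a0 (τ x t) x + a1 (τ x t) x * y x t + a2 (τ x t) x * y x t ^ 2) ∧
      (pdt q x t - c (τ x t) x * pdx q x t
        = a0 (τ x t) x - a1 (τ x t) x * q x t + a2 (τ x t) x * q x t ^ 2) ∧
      a2 (τ x t) x < 0 := by
  have hU : IsOpen (Set.Ioi (0 : ℝ) ×ˢ (Set.univ : Set ℝ)) := isOpen_Ioi.prod isOpen_univ
  have hmem : ∀ {v : ℝ}, 0 < v → ∀ x : ℝ, (v, x) ∈ Set.Ioi (0 : ℝ) ×ˢ (Set.univ : Set ℝ) :=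
    fun hv _ => ⟨hv, trivial⟩
  have hdiff : ∀ {g : ℝ → ℝ → ℝ}, ContDiffOn ℝ 1 (fun w : ℝ × ℝ => g w.1 w.2)
      (Set.Ioi 0 ×ˢ Set.univ) → ∀ {v : ℝ}, 0 < v → ∀ x,
      DifferentiableAt ℝ (fun w : ℝ × ℝ => g w.1 w.2) (v, x) := fun hg v hv x =>
    (hg.differentiableOn one_ne_zero).differentiableAt (hU.mem_nhds (hmem hv x))
  have hcpos : ∀ v > (0 : ℝ), ∀ x, 0 < c v x := fun v hv x => by
    rw [hc]
    exact Real.sqrt_pos.mpr (neg_pos.mpr (hPv v hv x))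
  have hPc : ∀ v > (0 : ℝ), ∀ x, dV P v x = -(c v x ^ 2) := fun v hv x => by
    rw [hc, Real.sq_sqrt (neg_pos.mpr (hPv v hv x)).le, neg_neg]
  have hcreg : ContDiffOn ℝ 2 (fun w : ℝ × ℝ => c w.1 w.2) (Set.Ioi 0 ×ˢ Set.univ) := by
    simp only [hc]
    exact (contDiffOn_dV hU (by norm_num) hPreg).neg.sqrt
      fun w hw => (neg_pos.mpr (hPv w.1 hw.1 w.2)).ne'
  have hMreg : ContDiffOn ℝ 2 (fun w : ℝ × ℝ => Pmu w.1 w.2) (Set.Ioi 0 ×ˢ Set.univ) := by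
    simp only [hPmu]
    exact (hcreg.neg.mul (contDiffOn_dX hU (by norm_num) hhreg)).add
      (contDiffOn_dX hU (by norm_num) hPreg)
  have hcreg₁ := hcreg.of_le (m := 1) (by norm_num)
  have hMreg₁ := hMreg.of_le (m := 1) (by norm_num)
  have hhreg₁ := hhreg.of_le (m := 1) (by norm_num)
  have hcsqV : ∀ v > (0 : ℝ), ∀ x, dV (dV P) v x = -(2 * c v x * dV c v x) := fun v hv x => by
    rw [dV_congr (g' := fun a b => -(c a b ^ 2)) hU (hmem hv x) fun w hw => hPc w.1 hw.1 w.2]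
    exact ((hasDerivAt_dV (hdiff hcreg₁ hv x)).pow 2).neg.deriv.trans (by ring)
  have hcsqX : ∀ v > (0 : ℝ), ∀ x, dX (dV P) v x = -(2 * c v x * dX c v x) := fun v hv x => by
    rw [dX_congr (g' := fun a b => -(c a b ^ 2)) hU (hmem hv x) fun w hw => hPc w.1 hw.1 w.2]
    exact ((hasDerivAt_dX (hdiff hcreg₁ hv x)).pow 2).neg.deriv.trans (by ring)
  have hhvx : ∀ v > (0 : ℝ), ∀ x, dX (dV h) v x = -dX c v x := fun v hv x => by
    rw [dX_congr (g' := fun a b => -(c a b)) hU (hmem hv x) fun w hw => hhv w.1 hw.1 w.2]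
    exact (hasDerivAt_dX (hdiff hcreg₁ hv x)).neg.deriv
  have hMv : ∀ v > (0 : ℝ), ∀ x,
      dV Pmu v x = -(dV c v x) * dX h v x - c v x * dX c v x := fun v hv x => by
    rw [dV_congr (g' := fun a b => -(c a b) * dX h a b + dX P a b) hU (hmem hv x)
      fun w _ => hPmu w.1 w.2]
    refine (((hasDerivAt_dV (hdiff hcreg₁ hv x)).neg.mul
      (hasDerivAt_dV (hdiff (contDiffOn_dX hU (by norm_num) hhreg) hv x))).add
      (hasDerivAt_dV (hdiff (contDiffOn_dX hU (by norm_num) hPreg) hv x))).deriv.trans ?_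
    rw [dV_dX_comm hU (hmem hv x) (hhreg.of_le (by norm_num)),
      dV_dX_comm hU (hmem hv x) (hPreg.of_le (by norm_num)), hhvx v hv x, hcsqX v hv x]
    simp only [Pi.neg_apply]
    ring
  have hG' : ∀ v > (0 : ℝ), ∀ x, G v x =
      -((dV Pmu v x * c v x - Pmu v x * dV c v x) / c v x ^ 2) / c v x := fun v hv x => by
    rw [hG]
    congr 2
    exact ((hasDerivAt_dV (hdiff hMreg₁ hv x)).div (hasDerivAt_dV (hdiff hcreg₁ hv x))
      (hcpos v hv x).ne').deriv
  have hGreg : ContDiffOn ℝ 1 (fun w : ℝ × ℝ => G w.1 w.2) (Set.Ioi 0 ×ˢ Set.univ) := by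
    simp only [hG]
    exact (contDiffOn_dV (n := 2) hU (by norm_num)
      (hMreg.div hcreg fun w hw => (hcpos w.1 hw.1 w.2).ne')).neg.div hcreg₁
      fun w hw => (hcpos w.1 hw.1 w.2).ne'
  have hkreg : ContDiffOn ℝ 1 (fun w : ℝ × ℝ => 1 / 2 * √(c w.1 w.2) * G w.1 w.2)
      (Set.Ioi 0 ×ˢ Set.univ) :=
    (contDiffOn_const.mul (hcreg₁.sqrt fun w hw => (hcpos w.1 hw.1 w.2).ne')).mul hGreg
  have hJd : ∀ v > (0 : ℝ), ∀ x, DifferentiableAt ℝ (fun w : ℝ × ℝ => J w.1 w.2) (h v x, x) ∧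
      dV J (h v x) x = 1 / 2 * √(c v x) * G v x := fun v hv x =>
    differentiableAt_integral_fiber_inverse (k := fun a b => 1 / 2 * √(c a b) * G a b) hhreg₁
      (fun v hv x => by rw [hhv v hv x]; exact (neg_neg_of_pos (hcpos v hv x)).ne) hT hh0 hkreg hJ hv
  have hmom' : ∀ x t, pdt u x t + c (τ x t) x *
      (-(c (τ x t) x) * pdx τ x t + dX h (τ x t) x) + Pmu (τ x t) x = 0 := fun x t => by
    have h1 : pdx (fun x' t' => P (τ x' t') x') x t =
        dV P (τ x t) x * pdx τ x t + dX P (τ x t) x * 1 :=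
      (hasDerivAt_comp_curve (α := fun x' => τ x' t) (β := fun x' => x')
        (hdiff (hPreg.of_le (by norm_num)) (hτpos x t) x)
        (hasDerivAt_dV (hτreg.differentiable (by norm_num) (x, t))) (hasDerivAt_id x)).deriv
    have h2 := hmom x t
    rw [h1, hPc _ (hτpos x t)] at h2
    rw [hPmu]
    linear_combination h2
  intro x t
  have hv := hτpos x t
  have riccati : ∀ {ε : ℝ} {Y : ℝ → ℝ → ℝ}, ε = 1 ∨ ε = -1 → _ → _ := fun {ε Y} hε hY =>
    riccati_along_characteristic (ε := ε) (Y := Y) hε hcpos hcreg₁ hMreg₁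
      (hhreg.of_le (by norm_num)) hhv hMv (fun v hv x => (hJd v hv x).1)
      (fun v hv x => by rw [(hJd v hv x).2, hG' v hv x]) hτreg hureg hτpos
      (fun x t => sub_eq_zero.mp (hmass x t)) hmom' hY x t rfl
  rw [ha0, ha1, ha2, hcH, hG' _ hv]
  refine ⟨?_, ?_, ?_⟩
  · have := riccati (ε := 1) (Y := y) (Or.inl rfl) fun x t => by
      rw [hy]
      simp only [one_mul]
      ring
    linear_combination this
  · have := riccati (ε := -1) (Y := q) (Or.inr rfl) fun x t => by
      rw [hq]
      simp only [neg_one_mul, ← sub_eq_add_neg]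
      ring
    linear_combination this
  · have hc0 := hcpos _ hv x
    have hcV : dV c (τ x t) x < 0 := by
      have h1 := hPvv _ hv x
      rw [hcsqV _ hv] at h1
      by_contra! h2
      have := mul_nonneg hc0.le h2
      linarith
    have hs0 : 0 < √(c (τ x t) x) := Real.sqrt_pos.mpr hc0
    simp only [neg_div, neg_neg]
    exact div_neg_of_neg_of_pos (div_neg_of_neg_of_pos hcV hc0) (by positivity)
end

section
/- Let 1 < γ ≤ 2 and let p̃(τ,x) = A(x)τ^{−γ} + B(x)τ^{−2} with A, B ∈ C¹, A(x) ≥ A_L > 0, and |A(x)|, |A'(x)|, |B(x)|, |B'(x)| ≤ M for all x. Then for all τ > 0 one has the identity (p̃_{xτ} p̃_τ − p̃_x p̃_{ττ}) τ^{2γ+2} = (γ A' + 2 B' τ^{γ−2})(γ A + 2 B τ^{γ−2}) − (A' + B' τ^{γ−2})(γ(γ+1) A + 6 B τ^{γ−2}). Consequently, for any τ_L > 0 there is a constant C depending only on γ, M, A_L, τ_L such that |(p̃_x / p̃_τ)_τ| = |(p̃_{xτ} p̃_τ − p̃_x p̃_{ττ}) / p̃_τ²| ≤ C for all τ ≥ τ_L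 and all x; in particular this bound is uniform as τ → ∞ (it does not require any upper bound on τ). -/
open Real

theorem hasDerivAt_rpow_combination (a b p q : ℝ) {t : ℝ} (ht : 0 < t) :
    HasDerivAt (fun v : ℝ => a * v ^ p + b * v ^ q)
      (a * (p * t ^ (p - 1)) + b * (q * t ^ (q - 1))) t :=
  ((Real.hasDerivAt_rpow_const (Or.inl ht.ne')).const_mul a).add
    ((Real.hasDerivAt_rpow_const (Or.inl ht.ne')).const_mul b)

section Pressure

variable {γ : ℝ} {A B : ℝ → ℝ} {ptil : ℝ → ℝ → ℝ}

theorem dX_pressure (hA : ContDiff ℝ 1 A) (hB : ContDiff ℝ 1 B)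
    (hp : ∀ v x, ptil v x = A x * v ^ (-γ) + B x * v ^ (-(2:ℝ))) (v x : ℝ) :
    dX ptil v x = deriv A x * v ^ (-γ) + deriv B x * v ^ (-(2:ℝ)) := by
  have hA' := (hA.differentiable one_ne_zero x).hasDerivAt
  have hB' := (hB.differentiable one_ne_zero x).hasDerivAt
  simp only [dX, hp]
  exact ((hA'.mul_const _).add (hB'.mul_const _)).deriv

theorem hasDerivAt_dX_pressure (hA : ContDiff ℝ 1 A) (hB : ContDiff ℝ 1 B)
    (hp : ∀ v x, ptil v x = A x * v ^ (-γ) + B x * v ^ (-(2:ℝ))) {t : ℝ} (ht : 0 < t) (x : ℝ) :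
    HasDerivAt (fun v => dX ptil v x)
      (deriv A x * (-γ * t ^ (-γ - 1)) + deriv B x * (-2 * t ^ (-(2:ℝ) - 1))) t := by
  simp only [dX_pressure hA hB hp]
  exact hasDerivAt_rpow_combination _ _ _ _ ht

theorem dV_pressure (hp : ∀ v x, ptil v x = A x * v ^ (-γ) + B x * v ^ (-(2:ℝ)))
    {t : ℝ} (ht : 0 < t) (x : ℝ) :
    dV ptil t x = A x * (-γ * t ^ (-γ - 1)) + B x * (-2 * t ^ (-(2:ℝ) - 1)) := by
  simp only [dV, hp]
  exact (hasDerivAt_rpow_combination _ _ _ _ ht).deriv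

theorem hasDerivAt_dV_pressure (hp : ∀ v x, ptil v x = A x * v ^ (-γ) + B x * v ^ (-(2:ℝ)))
    {t : ℝ} (ht : 0 < t) (x : ℝ) :
    HasDerivAt (fun v => dV ptil v x)
      (A x * -γ * ((-γ - 1) * t ^ (-γ - 1 - 1))
        + B x * -2 * ((-(2:ℝ) - 1) * t ^ (-(2:ℝ) - 1 - 1))) t := by
  refine (hasDerivAt_rpow_combination (A x * -γ) (B x * -2) (-γ - 1) (-(2:ℝ) - 1)
    ht).congr_of_eventuallyEq ?_
  filter_upwards [lt_mem_nhds ht] with v hv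
  rw [dV_pressure hp hv, mul_assoc, mul_assoc]

theorem dX_pressure_mul_rpow (hA : ContDiff ℝ 1 A) (hB : ContDiff ℝ 1 B)
    (hp : ∀ v x, ptil v x = A x * v ^ (-γ) + B x * v ^ (-(2:ℝ))) {t : ℝ} (ht : 0 < t) (x : ℝ) :
    dX ptil t x * t ^ γ = deriv A x + deriv B x * t ^ (γ - 2) := by
  have h1 : t ^ (-γ) * t ^ γ = 1 := by rw [← rpow_add ht]; simp
  have h2 : t ^ (-(2:ℝ)) * t ^ γ = t ^ (γ - 2) := by rw [← rpow_add ht]; ring_nf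
  rw [dX_pressure hA hB hp]
  linear_combination deriv A x * h1 + deriv B x * h2

theorem dV_dX_pressure_mul_rpow (hA : ContDiff ℝ 1 A) (hB : ContDiff ℝ 1 B)
    (hp : ∀ v x, ptil v x = A x * v ^ (-γ) + B x * v ^ (-(2:ℝ))) {t : ℝ} (ht : 0 < t) (x : ℝ) :
    dV (dX ptil) t x * t ^ (γ + 1) = -(γ * deriv A x + 2 * deriv B x * t ^ (γ - 2)) := by
  have h1 : t ^ (-γ - 1) * t ^ (γ + 1) = 1 := by rw [← rpow_add ht]; ring_nf; simp
  have h2 : t ^ (-(2:ℝ) - 1) * t ^ (γ + 1) = t ^ (γ - 2) := by rw [← rpow_add ht]; ring_nf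
  rw [dV, (hasDerivAt_dX_pressure hA hB hp ht x).deriv]
  linear_combination -γ * deriv A x * h1 - 2 * deriv B x * h2

theorem dV_pressure_mul_rpow (hp : ∀ v x, ptil v x = A x * v ^ (-γ) + B x * v ^ (-(2:ℝ)))
    {t : ℝ} (ht : 0 < t) (x : ℝ) :
    dV ptil t x * t ^ (γ + 1) = -(γ * A x + 2 * B x * t ^ (γ - 2)) := by
  have h1 : t ^ (-γ - 1) * t ^ (γ + 1) = 1 := by rw [← rpow_add ht]; ring_nf; simp
  have h2 : t ^ (-(2:ℝ) - 1) * t ^ (γ + 1) = t ^ (γ - 2) := by rw [← rpow_add ht]; ring_nf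
  rw [dV_pressure hp ht]
  linear_combination -γ * A x * h1 - 2 * B x * h2

theorem dV_dV_pressure_mul_rpow (hp : ∀ v x, ptil v x = A x * v ^ (-γ) + B x * v ^ (-(2:ℝ)))
    {t : ℝ} (ht : 0 < t) (x : ℝ) :
    dV (dV ptil) t x * t ^ (γ + 2) = γ * (γ + 1) * A x + 6 * B x * t ^ (γ - 2) := by
  have h1 : t ^ (-γ - 1 - 1) * t ^ (γ + 2) = 1 := by rw [← rpow_add ht]; ring_nf; simp
  have h2 : t ^ (-(2:ℝ) - 1 - 1) * t ^ (γ + 2) = t ^ (γ - 2) := by rw [← rpow_add ht]; ring_nf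
  rw [dV, (hasDerivAt_dV_pressure hp ht x).deriv]
  linear_combination γ * (γ + 1) * A x * h1 + 6 * B x * h2

theorem pressure_wronskian_mul_rpow (hA : ContDiff ℝ 1 A) (hB : ContDiff ℝ 1 B)
    (hp : ∀ v x, ptil v x = A x * v ^ (-γ) + B x * v ^ (-(2:ℝ))) {t : ℝ} (ht : 0 < t) (x : ℝ) :
    (dV (dX ptil) t x * dV ptil t x - dX ptil t x * dV (dV ptil) t x) * t ^ (2 * γ + 2)
      = (γ * deriv A x + 2 * deriv B x * t ^ (γ - 2)) * (γ * A x + 2 * B x * t ^ (γ - 2))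
        - (deriv A x + deriv B x * t ^ (γ - 2))
          * (γ * (γ + 1) * A x + 6 * B x * t ^ (γ - 2)) := by
  have h1 : t ^ (2 * γ + 2) = t ^ (γ + 1) * t ^ (γ + 1) := by rw [← rpow_add ht]; ring_nf
  have h2 : t ^ (2 * γ + 2) = t ^ γ * t ^ (γ + 2) := by rw [← rpow_add ht]; ring_nf
  rw [← dX_pressure_mul_rpow hA hB hp ht, ← dV_dV_pressure_mul_rpow hp ht,
    ← neg_mul_neg (γ * deriv A x + _), ← dV_dX_pressure_mul_rpow hA hB hp ht,
    ← dV_pressure_mul_rpow hp ht]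
  linear_combination dV (dX ptil) t x * dV ptil t x * h1 - dX ptil t x * dV (dV ptil) t x * h2

theorem dV_dX_div_dV_pressure (hA : ContDiff ℝ 1 A) (hB : ContDiff ℝ 1 B)
    (hp : ∀ v x, ptil v x = A x * v ^ (-γ) + B x * v ^ (-(2:ℝ))) {t : ℝ} (ht : 0 < t) {x : ℝ}
    (h0 : dV ptil t x ≠ 0) :
    dV (fun v x' => dX ptil v x' / dV ptil v x') t x
      = (dV (dX ptil) t x * dV ptil t x - dX ptil t x * dV (dV ptil) t x) / dV ptil t x ^ 2 :=
  deriv_fun_div (hasDerivAt_dX_pressure hA hB hp ht x).differentiableAt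
    (hasDerivAt_dV_pressure hp ht x).differentiableAt h0

end Pressure

theorem abs_sub_le_of_abs_le {γ M S a b a' b' s : ℝ} (hγ : 0 < γ) (hs : 0 ≤ s) (hsS : s ≤ S)
    (ha : |a| ≤ M) (ha' : |a'| ≤ M) (hb : |b| ≤ M) (hb' : |b'| ≤ M) :
    |(γ * a' + 2 * b' * s) * (γ * a + 2 * b * s)
        - (a' + b' * s) * (γ * (γ + 1) * a + 6 * b * s)|
      ≤ (γ * M + 2 * M * S) * (γ * M + 2 * M * S)
        + (M + M * S) * (γ * (γ + 1) * M + 6 * M * S) := by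
  have hM : 0 ≤ M := (abs_nonneg a).trans ha
  have key : ∀ c d u v : ℝ, 0 ≤ c → 0 ≤ d → |u| ≤ M → |v| ≤ M →
      |c * u + d * v * s| ≤ c * M + d * M * S := by
    intro c d u v hc hd hu hv
    refine (abs_add_le _ _).trans ?_
    rw [abs_mul, abs_mul, abs_mul, abs_of_nonneg hc, abs_of_nonneg hd, abs_of_nonneg hs]
    gcongr
  have h1 := key γ 2 a' b' hγ.le (by norm_num) ha' hb'
  have h2 := key γ 2 a b hγ.le (by norm_num) ha hb
  have h3 := key 1 1 a' b' (by norm_num) (by norm_num) ha' hb'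
  have h4 := key (γ * (γ + 1)) 6 a b (by positivity) (by norm_num) ha hb
  simp only [one_mul] at h3
  refine (abs_sub _ _).trans ?_
  rw [abs_mul, abs_mul]
  have := (abs_nonneg _).trans h1
  have := (abs_nonneg _).trans h3
  gcongr

/-- the key algebraic identity for the MHD pressure
`p̃ = A τ^{-γ} + B τ^{-2}`, and the resulting uniform bound on
`(p̃_x/p̃_τ)_τ` for `τ ≥ τ_L`, independent of any upper bound on `τ`. -/
theorem stmt13
    (γ M AL : ℝ) (hγ1 : 1 < γ) (hγ2 : γ ≤ 2) (hM : 0 < M) (hAL : 0 < AL) :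
    (∀ A B : ℝ → ℝ,
      ContDiff ℝ 1 A → ContDiff ℝ 1 B →
      (∀ x, AL ≤ A x) → (∀ x, 0 ≤ B x) →
      (∀ x, |A x| ≤ M ∧ |deriv A x| ≤ M ∧ |B x| ≤ M ∧ |deriv B x| ≤ M) →
      ∀ ptil : ℝ → ℝ → ℝ,
        (∀ v x, ptil v x = A x * v ^ (-γ) + B x * v ^ (-(2:ℝ))) →
        ∀ x : ℝ, ∀ t > (0:ℝ),
          (dV (dX ptil) t x * dV ptil t x - dX ptil t x * dV (dV ptil) t x)
              * t ^ (2 * γ + 2)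
            = (γ * deriv A x + 2 * deriv B x * t ^ (γ - 2))
                * (γ * A x + 2 * B x * t ^ (γ - 2))
              - (deriv A x + deriv B x * t ^ (γ - 2))
                * (γ * (γ + 1) * A x + 6 * B x * t ^ (γ - 2))) ∧
    (∀ tauL > (0:ℝ), ∃ C : ℝ,
      ∀ A B : ℝ → ℝ,
      ContDiff ℝ 1 A → ContDiff ℝ 1 B →
      (∀ x, AL ≤ A x) → (∀ x, 0 ≤ B x) →
      (∀ x, |A x| ≤ M ∧ |deriv A x| ≤ M ∧ |B x| ≤ M ∧ |deriv B x| ≤ M) →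
      ∀ ptil : ℝ → ℝ → ℝ,
        (∀ v x, ptil v x = A x * v ^ (-γ) + B x * v ^ (-(2:ℝ))) →
        ∀ x t : ℝ, tauL ≤ t →
          |dV (fun v x' => dX ptil v x' / dV ptil v x') t x|
            = |(dV (dX ptil) t x * dV ptil t x - dX ptil t x * dV (dV ptil) t x)
                / dV ptil t x ^ 2| ∧
          |(dV (dX ptil) t x * dV ptil t x - dX ptil t x * dV (dV ptil) t x)
                / dV ptil t x ^ 2| ≤ C) := by
  refine ⟨fun A B hA hB _ _ _ ptil hp x t ht => pressure_wronskian_mul_rpow hA hB hp ht x,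
    fun tauL hL => ?_⟩
  have hγ : 0 < γ := by linarith
  refine ⟨((γ * M + 2 * M * tauL ^ (γ - 2)) * (γ * M + 2 * M * tauL ^ (γ - 2))
        + (M + M * tauL ^ (γ - 2)) * (γ * (γ + 1) * M + 6 * M * tauL ^ (γ - 2))) / (γ * AL) ^ 2,
    fun A B hA hB hAlow hB0 hbd ptil hp x t hLt => ?_⟩
  have ht : 0 < t := hL.trans_le hLt
  have hden : γ * AL ≤ γ * A x + 2 * B x * t ^ (γ - 2) := by
    have h1 := mul_le_mul_of_nonneg_left (hAlow x) hγ.le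
    have h2 : 0 ≤ 2 * B x * t ^ (γ - 2) := by have := hB0 x; positivity
    linarith
  have hpos : 0 < γ * AL := by positivity
  have hpv := dV_pressure_mul_rpow hp ht x
  have h0 : dV ptil t x ≠ 0 := by
    intro h
    rw [h, zero_mul] at hpv
    linarith
  refine ⟨congrArg _ (dV_dX_div_dV_pressure hA hB hp ht h0), ?_⟩
  have hsq : dV ptil t x ^ 2 * t ^ (2 * γ + 2) = (γ * A x + 2 * B x * t ^ (γ - 2)) ^ 2 := by
    rw [← neg_sq (γ * A x + _), ← hpv, mul_pow, ← rpow_natCast (t ^ (γ + 1)), ← rpow_mul ht.le]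
    push_cast
    ring_nf
  rw [← mul_div_mul_right _ _ (rpow_pos_of_pos ht (2 * γ + 2)).ne', hsq,
    pressure_wronskian_mul_rpow hA hB hp ht x, abs_div, abs_sq]
  obtain ⟨ha, ha', hb, hb'⟩ := hbd x
  have hnum := abs_sub_le_of_abs_le hγ (rpow_nonneg ht.le (γ - 2))
    (rpow_le_rpow_of_nonpos hL hLt (by linarith)) ha ha' hb hb'
  exact div_le_div₀ ((abs_nonneg _).trans hnum) hnum (by positivity)
    (pow_le_pow_left₀ hpos.le hden 2)
end

section
/- Consider isentropic (m ≡ 1) spherically symmetric Euler flow with a(r) = r² and γ > 1, γ ≠ 5/3, γ ≠ 3, so that the decoupled Riccati coefficients take the form d₀ = r^{(γ−3)/2 − 2} ρ^{(γ−3)/4}(G₁ u ρ^{(γ−1)/2} + G₂ ρ^{γ−1} + G₃ u²), d₁ = r^{−1}(G₄ u + G₅ ρ^{(γ−1)/2}), d₂ = −((γ+1)/(γ−1)) K_c K_τ^{(3−γ)/4} r^{(3−γ)/2} ρ^{(3−γ)/4}, for constants G₁,…,G₅ depending only on γ and K. Then there exist nonnegative constants Ĝ₆, Ĝ₇ depending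 only on γ and K such that whenever d₁² − 4 d₀ d₂ ≥ 0, both roots β_± = (−d₁ ± √(d₁² − 4 d₀ d₂))/(2 d₂) of the quadratic d₀ + d₁ β + d₂ β² = 0 satisfy β_± ≥ −r^{(γ−5)/2} ρ^{(γ−3)/4}(Ĝ₆ |u| + Ĝ₇ ρ^{(γ−1)/2}). -/
open Real

/-- A quadratic form in `(u, w)` is at most the sum of the absolute values of its coefficients
times `(|u| + w) ^ 2`. -/
lemma quadratic_form_le {G1 G2 G3 u w : ℝ} (hw : 0 ≤ w) :
    G1 * u * w + G2 * w ^ 2 + G3 * u ^ 2 ≤ (|G1| + |G2| + |G3|) * (|u| + w) ^ 2 := by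
  have hu := abs_nonneg u
  have h1 : G1 * u * w ≤ |G1| * (|u| + w) ^ 2 := by
    calc G1 * u * w ≤ |G1 * u * w| := le_abs_self _
      _ = |G1| * (|u| * w) := by rw [abs_mul, abs_mul, abs_of_nonneg hw, mul_assoc]
      _ ≤ _ := by gcongr; nlinarith [mul_nonneg hu hw, sq_nonneg u]
  have h2 : G2 * w ^ 2 ≤ |G2| * (|u| + w) ^ 2 := by
    gcongr
    · exact le_abs_self _
    · linarith
  have h3 : G3 * u ^ 2 ≤ |G3| * (|u| + w) ^ 2 := by
    rw [← sq_abs u]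
    gcongr
    · exact le_abs_self _
    · linarith
  linarith

lemma abs_linear_form_le {G4 G5 u w : ℝ} (hw : 0 ≤ w) :
    |G4 * u + G5 * w| ≤ (|G4| + |G5|) * (|u| + w) := by
  have h := abs_add_le (G4 * u) (G5 * w)
  rw [abs_mul, abs_mul, abs_of_nonneg hw] at h
  nlinarith [mul_nonneg (abs_nonneg G4) hw, mul_nonneg (abs_nonneg G5) (abs_nonneg u)]

/-- If `|d₁| ≤ A * L`, `d₁² - 4 d₀ d₂ ≤ (A² + B) L²` and `d₂ < 0`, both roots of the quadratic
`d₀ + d₁ β + d₂ β²` are at least `(2 A + B + 1) * L / (2 d₂)`. -/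
lemma roots_ge {d1 D d2 A B L : ℝ} (hd2 : d2 < 0) (hA : 0 ≤ A) (hB : 0 ≤ B) (hL : 0 ≤ L)
    (h1 : |d1| ≤ A * L) (hD : D ≤ (A ^ 2 + B) * L ^ 2) :
    (2 * A + B + 1) * L / (2 * d2) ≤ (-d1 + √D) / (2 * d2) ∧
      (2 * A + B + 1) * L / (2 * d2) ≤ (-d1 - √D) / (2 * d2) := by
  have hs : √D ≤ (A + B + 1) * L := by
    refine Real.sqrt_le_iff.mpr ⟨by positivity, hD.trans ?_⟩
    rw [mul_pow]
    gcongr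
    nlinarith [mul_nonneg hA hB]
  have h2 : 2 * d2 ≤ 0 := by linarith
  have h0 := Real.sqrt_nonneg D
  obtain ⟨h3, h4⟩ := abs_le.mp h1
  constructor <;> exact div_le_div_of_nonpos_of_le h2 (by linarith)

/-- lower bound on the roots of the quadratic `d₀ + d₁ β + d₂ β²`
arising from the decoupled Riccati equations for isentropic spherically
symmetric Euler flow (`a(r) = r²`). -/
theorem stmt17
    (K γ : ℝ) (hK : 0 < K) (hγ : 1 < γ) (h53 : γ ≠ 5 / 3) (h3 : γ ≠ 3)
    (Ktau Kc : ℝ)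
    (hKtau : Ktau = (2 * Real.sqrt (K * γ) / (γ - 1)) ^ ((2:ℝ) / (γ - 1)))
    (hKc : Kc = Real.sqrt (K * γ) * Ktau ^ (-((γ + 1) / 2)))
    (G1 G2 G3 G4 G5 : ℝ) :
    ∃ G6 ≥ (0:ℝ), ∃ G7 ≥ (0:ℝ),
      ∀ (r ρ u : ℝ), 0 < r → 0 < ρ →
        ∀ d0 d1 d2 : ℝ,
        d0 = r ^ ((γ - 3) / 2 - 2) * ρ ^ ((γ - 3) / 4)
            * (G1 * u * ρ ^ ((γ - 1) / 2) + G2 * ρ ^ (γ - 1) + G3 * u ^ 2) →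
        d1 = r⁻¹ * (G4 * u + G5 * ρ ^ ((γ - 1) / 2)) →
        d2 = -((γ + 1) / (γ - 1)) * Kc * Ktau ^ ((3 - γ) / 4)
            * r ^ ((3 - γ) / 2) * ρ ^ ((3 - γ) / 4) →
        0 ≤ d1 ^ 2 - 4 * d0 * d2 →
        ((-d1 + Real.sqrt (d1 ^ 2 - 4 * d0 * d2)) / (2 * d2)
            ≥ -(r ^ ((γ - 5) / 2) * ρ ^ ((γ - 3) / 4)
                * (G6 * |u| + G7 * ρ ^ ((γ - 1) / 2))) ∧
         (-d1 - Real.sqrt (d1 ^ 2 - 4 * d0 * d2)) / (2 * d2)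
            ≥ -(r ^ ((γ - 5) / 2) * ρ ^ ((γ - 3) / 4)
                * (G6 * |u| + G7 * ρ ^ ((γ - 1) / 2)))) := by
  have hKt : 0 < Ktau := by
    have : 0 < γ - 1 := by linarith
    rw [hKtau]
    positivity
  obtain ⟨C, hC, hCdef⟩ : ∃ C : ℝ, 0 < C ∧ C = (γ + 1) / (γ - 1) * Kc * Ktau ^ ((3 - γ) / 4) := by
    refine ⟨_, ?_, rfl⟩
    have : 0 < γ - 1 := by linarith
    rw [hKc]
    positivity
  set A := |G4| + |G5|
  set B := 4 * C * (|G1| + |G2| + |G3|) with hBdef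
  have hA : 0 ≤ A := by positivity
  have hB : 0 ≤ B := by positivity
  refine ⟨(2 * A + B + 1) / (2 * C), by positivity, (2 * A + B + 1) / (2 * C), by positivity, ?_⟩
  intro r ρ u hr hρ d0 d1 d2 hd0 hd1 hd2 _
  have hr0 : r ^ ((γ - 3) / 2 - 2) = (r ^ ((3 - γ) / 2))⁻¹ * r⁻¹ ^ 2 := by
    rw [rpow_sub hr, ← rpow_neg hr.le, rpow_two, div_eq_mul_inv, inv_pow]
    ring_nf
  have hr1 : r ^ ((γ - 5) / 2) = (r ^ ((3 - γ) / 2))⁻¹ * r⁻¹ := by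
    rw [← rpow_neg hr.le, ← rpow_neg_one, ← rpow_add hr]
    ring_nf
  have hρ1 : ρ ^ ((γ - 3) / 4) = (ρ ^ ((3 - γ) / 4))⁻¹ := by
    rw [← rpow_neg hρ.le]
    ring_nf
  have hρ2 : ρ ^ (γ - 1) = (ρ ^ ((γ - 1) / 2)) ^ 2 := by
    rw [← rpow_natCast, ← rpow_mul hρ.le]
    ring_nf
  rw [hr0, hρ1, hρ2] at hd0
  rw [hr1, hρ1]
  have hP : 0 < r ^ ((3 - γ) / 2) := by positivity
  have hR : 0 < ρ ^ ((3 - γ) / 4) := by positivity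
  have hw : 0 < ρ ^ ((γ - 1) / 2) := by positivity
  generalize r ^ ((3 - γ) / 2) = P at *
  generalize ρ ^ ((3 - γ) / 4) = R at *
  generalize ρ ^ ((γ - 1) / 2) = w at *
  have hd2' : d2 = -(C * P * R) := by rw [hd2, hCdef]; ring
  have hneg : d2 < 0 := by rw [hd2']; linarith [mul_pos (mul_pos hC hP) hR]
  have hlin := abs_linear_form_le (G4 := G4) (G5 := G5) (u := u) hw.le
  have h1 : |d1| ≤ A * (r⁻¹ * (|u| + w)) := by
    rw [hd1, abs_mul, abs_of_pos (inv_pos.mpr hr), mul_left_comm]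
    gcongr
  have hprod : d0 * d2 = -(r⁻¹ ^ 2 * C * (G1 * u * w + G2 * w ^ 2 + G3 * u ^ 2)) := by
    rw [hd0, hd2']
    field_simp
  have hD : d1 ^ 2 - 4 * d0 * d2 ≤ (A ^ 2 + B) * (r⁻¹ * (|u| + w)) ^ 2 := by
    have hsq : d1 ^ 2 ≤ (A * (r⁻¹ * (|u| + w))) ^ 2 := sq_le_sq' (abs_le.mp h1).1 (abs_le.mp h1).2
    have hq := mul_le_mul_of_nonneg_left
      (quadratic_form_le (G1 := G1) (G2 := G2) (G3 := G3) (u := u) hw.le)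
      (by positivity : 0 ≤ 4 * (r⁻¹ ^ 2 * C))
    calc d1 ^ 2 - 4 * d0 * d2
        = d1 ^ 2 + 4 * (r⁻¹ ^ 2 * C) * (G1 * u * w + G2 * w ^ 2 + G3 * u ^ 2) := by
          linear_combination -4 * hprod
      _ ≤ _ := add_le_add hsq hq
      _ = _ := by rw [hBdef]; ring
  have hbound : -(P⁻¹ * r⁻¹ * R⁻¹
      * ((2 * A + B + 1) / (2 * C) * |u| + (2 * A + B + 1) / (2 * C) * w))
      = (2 * A + B + 1) * (r⁻¹ * (|u| + w)) / (2 * d2) := by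
    rw [hd2']
    field_simp
  rw [hbound]
  exact roots_ge hneg hA hB (by positivity) h1 hD
end
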